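/- Let g be a finite-dimensional simple Lie algebra over an algebraically closed field K of characteristic 0. A linear map φ : g → g is a local automorphism of g if and only if φ is an automorphism of g or an anti-automorphism of g. -/

import Mathlib

/-- A linear map `φ : L → L` is a *local automorphism* of the Lie algebra `L` if for
every `x ∈ L` there exists a Lie algebra automorphism `e` of `L` with `φ x = e x`. -/
def IsLocalAutomorphism (K L : Type*) [Field K] [LieRing L] [LieAlgebra K L]
    (φ : L →ₗ[K] L) : Prop :=
  ∀ x : L, ∃ e : L ≃ₗ⁅K⁆ L, φ x = e x

open LieAlgebra LieAlgebra.IsKilling LieModule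

theorem LieEquiv.symm_trans_apply_of_eq {K L₁ L₂ L₃ : Type*} [CommRing K]
    [LieRing L₁] [LieRing L₂] [LieRing L₃] [LieAlgebra K L₁] [LieAlgebra K L₂] [LieAlgebra K L₃]
    (e₁ : L₁ ≃ₗ⁅K⁆ L₂) (e₂ : L₁ ≃ₗ⁅K⁆ L₃) (s : L₁) {x : L₂} {y : L₃}
    (hx : e₁ s = x) (hy : e₂ s = y) : (e₁.symm.trans e₂) x = y := by
  simp [← hx, ← hy, LieEquiv.trans_apply]

section ChevalleyInvolution

variable {K L : Type*} [Field K] [CharZero K] [LieRing L] [LieAlgebra K L] [FiniteDimensional K L]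
  [IsKilling K L] {H : LieSubalgebra K L} [H.IsCartanSubalgebra] [IsTriangularizable K H L]

theorem LieAlgebra.IsKilling.exists_smul_eq_of_mem_rootSpace {α : Weight K H L}
    (hα : α.IsNonZero) {x y : L} (hx : x ∈ rootSpace H α) (hy : y ∈ rootSpace H α)
    (hx0 : x ≠ 0) : ∃ c : K, c • x = y := by
  have := (finrank_eq_one_iff_of_nonzero' (⟨x, hx⟩ : rootSpace H α)
    (by simpa using hx0)).mp (finrank_rootSpace_eq_one α hα) ⟨y, hy⟩
  simpa [Subtype.ext_iff] using this

/-- The bracket of root vectors is nonzero whenever the sum of the roots is a root. -/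
theorem LieAlgebra.IsKilling.lie_ne_zero_of_mem_rootSpace {α β γ : Weight K H L}
    (hα : α.IsNonZero) (hβ : β.IsNonZero) (h : (γ : H → K) = α + β)
    {x y : L} (hx : x ∈ rootSpace H α) (hy : y ∈ rootSpace H β) (hx0 : x ≠ 0) (hy0 : y ≠ 0) :
    ⁅x, y⁆ ≠ 0 := by
  intro hxy
  obtain ⟨t, e, f, ht, he, hf⟩ := exists_isSl2Triple_of_weight_isNonZero hα
  obtain rfl := ht.h_eq_coroot hα he hf
  obtain ⟨c, rfl⟩ := exists_smul_eq_of_mem_rootSpace hα hx he hx0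
  have hey : ⁅c • x, y⁆ = 0 := by simp [hxy]
  obtain ⟨n, hn⟩ := IsSl2Triple.HasPrimitiveVectorWith.exists_nat (R := K) (t := ht) (m := y)
    (μ := β (coroot α)) ⟨hy0, by simpa using lie_eq_smul_of_mem_rootSpace hy (coroot α), hey⟩
  obtain ⟨z, hz, hz0⟩ : ∃ z ∈ rootSpace H (-γ), z ≠ 0 := (-γ).exists_ne_zero
  have hxz : ⁅c • x, z⁆ = 0 := by
    have hmem : ⁅c • x, z⁆ ∈ rootSpace H (-β) := by
      have := lie_mem_genWeightSpace_of_mem_genWeightSpace he hz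
      rwa [h, neg_add, add_neg_cancel_left] at this
    have := mem_ker_killingForm_of_mem_rootSpace_of_forall_rootSpace_neg K L H hmem ?_
    · simpa using this
    intro w hw
    rw [neg_neg] at hw
    obtain ⟨d, rfl⟩ := exists_smul_eq_of_mem_rootSpace hβ hy hw hy0
    rw [← lie_skew, map_neg, LinearMap.neg_apply, LieModule.traceForm_apply_lie_apply, lie_smul,
      hey]
    simp
  obtain ⟨m, hm⟩ := IsSl2Triple.HasPrimitiveVectorWith.exists_nat (R := K) (t := ht) (m := z)
    (μ := (-γ) (coroot α)) ⟨hz0, by simpa using lie_eq_smul_of_mem_rootSpace hz (coroot α), hxz⟩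
  have h2 : ((n + 2 + m : ℕ) : K) = 0 := by
    have h3 : (-γ) (coroot α) = - (α (coroot α) + β (coroot α)) := by
      rw [Weight.coe_neg, h]; rfl
    rw [h3, root_apply_coroot hα, hn] at hm
    push_cast
    linear_combination -hm
  rw [Nat.cast_eq_zero] at h2
  omega

theorem LieAlgebra.IsKilling.rootSpace_le_of_mem {α : Weight K H L} (hα : α.IsNonZero)
    {S : LieSubalgebra K L} {x : L} (hx : x ∈ rootSpace H α) (hx0 : x ≠ 0) (hxS : x ∈ S) :
    ∀ y ∈ rootSpace H α, y ∈ S := by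
  intro y hy
  obtain ⟨c, rfl⟩ := exists_smul_eq_of_mem_rootSpace hα hx hy hx0
  exact S.smul_mem c hxS

theorem LieAlgebra.IsKilling.rootSpace_le_of_add {α β γ : Weight K H L}
    (hα : α.IsNonZero) (hβ : β.IsNonZero) (hγ : γ.IsNonZero) (h : (γ : H → K) = α + β)
    {S : LieSubalgebra K L} (hαS : ∀ x ∈ rootSpace H α, x ∈ S)
    (hβS : ∀ x ∈ rootSpace H β, x ∈ S) : ∀ x ∈ rootSpace H γ, x ∈ S := by
  obtain ⟨x, hx, hx0⟩ := α.exists_ne_zero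
  obtain ⟨y, hy, hy0⟩ := β.exists_ne_zero
  refine rootSpace_le_of_mem (x := ⁅x, y⁆) hγ ?_
    (lie_ne_zero_of_mem_rootSpace hα hβ h hx hy hx0 hy0) (S.lie_mem (hαS x hx) (hβS y hy))
  rw [h]
  exact lie_mem_genWeightSpace_of_mem_genWeightSpace hx hy

omit [CharZero K] [IsKilling K L] [IsTriangularizable K H L] in
theorem LieAlgebra.IsKilling.isNonZero_root (i : LieSubalgebra.root (H := H)) :
    (i : Weight K H L).IsNonZero :=
  (Finset.mem_filter.mp i.property).2

theorem LieAlgebra.IsKilling.rootSpace_le_of_isPos (b : (rootSystem H).Base)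
    {S : LieSubalgebra K L}
    (hS : ∀ i ∈ b.support, ∀ x ∈ rootSpace H (i : Weight K H L), x ∈ S)
    (i : LieSubalgebra.root (H := H)) (hi : b.IsPos i) :
    ∀ x ∈ rootSpace H (i : Weight K H L), x ∈ S := by
  refine hi.induction_on_add (p := fun i ↦ ∀ x ∈ rootSpace H (i : Weight K H L), x ∈ S) hS ?_
  intro i j k hk hi hj
  simp only [rootSystem_root_apply] at hk
  exact rootSpace_le_of_add (isNonZero_root i) (isNonZero_root j) (isNonZero_root k)
    (congrArg DFunLike.coe hk) hi (hS j hj)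

theorem LieAlgebra.IsKilling.rootSpace_neg_le_of_isPos (b : (rootSystem H).Base)
    {S : LieSubalgebra K L}
    (hS : ∀ i ∈ b.support, ∀ x ∈ rootSpace H (-(i : Weight K H L) : Weight K H L), x ∈ S)
    (i : LieSubalgebra.root (H := H)) (hi : b.IsPos i) :
    ∀ x ∈ rootSpace H (-(i : Weight K H L) : Weight K H L), x ∈ S := by
  refine hi.induction_on_add
    (p := fun i ↦ ∀ x ∈ rootSpace H (-(i : Weight K H L) : Weight K H L), x ∈ S) hS ?_
  intro i j k hk hi hj
  simp only [rootSystem_root_apply] at hk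
  refine rootSpace_le_of_add (α := -(i : Weight K H L)) (β := -(j : Weight K H L))
    (by simpa using isNonZero_root i) (by simpa using isNonZero_root j)
    (by simpa using isNonZero_root k) ?_ hi (hS j hj)
  have hk' : ((k : Weight K H L) : H → K) = (i : Weight K H L) + (j : Weight K H L) :=
    congrArg DFunLike.coe hk
  rw [Weight.coe_neg, Weight.coe_neg, Weight.coe_neg, hk', neg_add]

theorem LieAlgebra.IsKilling.eq_top_of_rootSpace_le (b : (rootSystem H).Base)
    {S : LieSubalgebra K L} (hH : H ≤ S)
    (hS : ∀ i ∈ b.support, ∀ x ∈ rootSpace H (i : Weight K H L), x ∈ S)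
    (hS' : ∀ i ∈ b.support, ∀ x ∈ rootSpace H (-(i : Weight K H L) : Weight K H L), x ∈ S) :
    S = ⊤ := by
  rw [eq_top_iff, ← LieSubalgebra.toSubmodule_le_toSubmodule]
  have htop := congrArg LieSubmodule.toSubmodule (iSup_genWeightSpace_eq_top' K H L)
  rw [LieSubmodule.iSup_toSubmodule] at htop
  simp only [LieSubmodule.top_toSubmodule] at htop
  rw [LieSubalgebra.top_toSubmodule, ← htop, iSup_le_iff]
  intro χ x hx
  by_cases hχ : χ.IsZero
  · refine hH ?_
    have : x ∈ rootSpace H (0 : H → K) := by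
      rw [← hχ.eq]; exact hx
    rwa [rootSpace_zero_eq] at this
  · have hmem : χ ∈ LieSubalgebra.root (H := H) := by simpa using hχ
    have hor := RootPairing.Base.IsPos.or_neg b ⟨χ, hmem⟩
    let := (rootSystem H).indexNeg
    obtain h | h := hor
    · exact rootSpace_le_of_isPos b hS _ h x hx
    · refine rootSpace_neg_le_of_isPos b hS' _ h x ?_
      have h2 : (rootSystem H).root (-⟨χ, hmem⟩) = -(rootSystem H).root ⟨χ, hmem⟩ := by
        rw [RootPairing.indexNeg_neg, RootPairing.root_reflectionPerm,
          RootPairing.reflection_apply_self]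
      simp only [rootSystem_root_apply] at h2
      have h3 : (((-⟨χ, hmem⟩ : LieSubalgebra.root (H := H)) : Weight K H L) : H → K) = -χ :=
        congrArg DFunLike.coe h2
      rw [Weight.coe_neg, h3, neg_neg]
      exact hx

variable (H) in
/-- Every Killing Lie algebra with a splitting Cartan subalgebra has a basis
in the sense of `LieAlgebra.Basis`. -/
theorem LieAlgebra.IsKilling.exists_basis :
    ∃ b : (rootSystem H).Base, Nonempty (LieAlgebra.Basis b.support H) := by
  obtain ⟨b⟩ := (rootSystem H).nonempty_base
  choose t e f ht he hf using fun i : b.support ↦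
    exists_isSl2Triple_of_weight_isNonZero (isNonZero_root i.1)
  have hcoroot (i : b.support) : t i = coroot (i : Weight K H L) :=
    (ht i).h_eq_coroot (isNonZero_root i.1) (he i) (hf i)
  have hspan : Submodule.span K (Set.range t) = H.toSubmodule := by
    have h1 := b.span_coroot_support
    have h1' : (rootSystem H).corootSpan K = ⊤ :=
      RootPairing.IsRootSystem.span_coroot_eq_top
    rw [h1'] at h1
    have h2 : Set.range t = H.toSubmodule.subtype '' ((rootSystem H).coroot '' b.support) := by
      ext x
      simp [hcoroot]
    rw [h2, ← Submodule.map_span, h1]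
    simp
  have hA (i j : b.support) :
      (b.cartanMatrix i j : K) = (i : Weight K H L) (coroot (j : Weight K H L)) := by
    rw [← rootSystem_pairing_apply, ← RootPairing.algebraMap_pairingIn _ ℤ]
    rfl
  have hab (i j : b.support) : ⁅t i, t j⁆ = 0 := by
    rw [hcoroot, hcoroot]
    have := trivial_lie_zero H H (coroot (i : Weight K H L)) (coroot (j : Weight K H L))
    simpa [Subtype.ext_iff] using this
  have hlieSpan : H = LieSubalgebra.lieSpan K L (Set.range t) := by
    rw [← LieSubalgebra.toSubmodule_inj, ← hspan,
      LieSubalgebra.coe_lieSpan_eq_span_of_forall_lie_eq_zero]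
    rintro - ⟨i, rfl⟩ - ⟨j, rfl⟩
    exact hab i j
  refine ⟨b, ⟨⟨b.cartanMatrix, t, e, f, hlieSpan, ?_, ?_, b.cartanMatrix_nondegenerate, ht, hab,
    ?_, ?_, ?_⟩⟩⟩
  · set S := LieSubalgebra.lieSpan K L (Set.range e ∪ Set.range f)
    have heS (i) : e i ∈ S := LieSubalgebra.subset_lieSpan (Or.inl ⟨i, rfl⟩)
    have hfS (i) : f i ∈ S := LieSubalgebra.subset_lieSpan (Or.inr ⟨i, rfl⟩)
    have hHS : H ≤ S := by
      intro x hx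
      rw [hlieSpan] at hx
      refine LieSubalgebra.lieSpan_le.mpr ?_ hx
      rintro - ⟨i, rfl⟩
      rw [← (ht i).lie_e_f]
      exact S.lie_mem (heS i) (hfS i)
    exact eq_top_of_rootSpace_le b hHS
      (fun i hi ↦ rootSpace_le_of_mem (isNonZero_root i) (he ⟨i, hi⟩) (ht ⟨i, hi⟩).e_ne_zero
        (heS ⟨i, hi⟩))
      (fun i hi ↦ rootSpace_le_of_mem (α := -(i : Weight K H L))
        (by simpa using isNonZero_root i) (by simpa using hf ⟨i, hi⟩) (ht ⟨i, hi⟩).f_ne_zero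
        (hfS ⟨i, hi⟩))
  · have := b.linearIndepOn_coroot
    have h2 : t = H.toSubmodule.subtype ∘ fun i : b.support ↦ (rootSystem H).coroot i := by
      ext i
      simp [hcoroot]
    rw [h2]
    exact LinearIndependent.map' this _ H.toSubmodule.ker_subtype
  · intro i j
    have := lie_eq_smul_of_mem_rootSpace (he i) (coroot (j : Weight K H L))
    rw [← hA, LieSubalgebra.coe_bracket_of_module, ← hcoroot] at this
    rw [this, Int.cast_smul_eq_zsmul]
  · intro i j
    have := lie_eq_smul_of_mem_rootSpace (hf i) (coroot (j : Weight K H L))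
    rw [Pi.neg_apply, ← hA, LieSubalgebra.coe_bracket_of_module, ← hcoroot] at this
    rw [this, neg_smul, neg_smul, Int.cast_smul_eq_zsmul]
  · intro i j hij
    by_contra hne
    have hmem := lie_mem_genWeightSpace_of_mem_genWeightSpace (he i) (hf j)
    have hbot : genWeightSpace L ((i : Weight K H L) + -(j : Weight K H L) : H → K) ≠ ⊥ := by
      intro h0
      rw [h0] at hmem
      exact hne (by simpa using hmem)
    let χ : Weight K H L := ⟨_, hbot⟩
    by_cases hχ : χ.IsZero
    · refine hij (Subtype.ext (Subtype.ext (Weight.ext fun x ↦ ?_)))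
      have := congrFun hχ.eq x
      simpa [χ, ← sub_eq_add_neg, sub_eq_zero] using this
    · refine b.sub_notMem_range_root i.2 j.2 ⟨⟨χ, by simpa using hχ⟩, ?_⟩
      ext x
      simp [χ, sub_eq_add_neg]

end ChevalleyInvolution

/-- A Lie algebra basis of a simple Lie algebra has a Chevalley involution. -/
theorem LieAlgebra.Basis.exists_equiv_apply_h_eq_neg {K L ι : Type*} [Field K] [CharZero K]
    [LieRing L] [LieAlgebra K L] [FiniteDimensional K L] [LieAlgebra.IsSimple K L] [Finite ι]
    {H : LieSubalgebra K L} (b : LieAlgebra.Basis ι H) :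
    ∃ ω : L ≃ₗ⁅K⁆ L, ∀ i, ω (b.h i) = -b.h i := by
  refine ⟨b.equivOfReindex (Equiv.refl ι) b.symm rfl, fun i ↦ ?_⟩
  unfold LieAlgebra.Basis.equivOfReindex
  have hm : (b.h i, -b.h i) ∈ LieSubalgebra.lieSpan K (L × L)
      ({x | ∃ i, (b.h i, b.symm.h ((Equiv.refl ι) i)) = x} ∪
        {x | ∃ i, (b.e i, b.symm.e ((Equiv.refl ι) i)) = x} ∪
          {x | ∃ i, (b.f i, b.symm.f ((Equiv.refl ι) i)) = x}) :=
    LieSubalgebra.subset_lieSpan (Or.inl (Or.inl ⟨i, rfl⟩))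
  exact LieEquiv.symm_trans_apply_of_eq _ _ (Subtype.mk (b.h i, -b.h i) hm) rfl rfl

/-- A simple Lie algebra over an algebraically closed field has an automorphism that acts as `-1`
on a given Cartan subalgebra. -/
theorem LieAlgebra.exists_equiv_eq_neg_on_cartan {K L : Type*} [Field K] [IsAlgClosed K]
    [CharZero K] [LieRing L] [LieAlgebra K L] [FiniteDimensional K L] [LieAlgebra.IsSimple K L]
    (H : LieSubalgebra K L) [H.IsCartanSubalgebra] :
    ∃ ω : L ≃ₗ⁅K⁆ L, ∀ x ∈ H, ω x = -x := by
  obtain ⟨_, ⟨b⟩⟩ := exists_basis H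
  obtain ⟨ω, hω⟩ := b.exists_equiv_apply_h_eq_neg
  refine ⟨ω, fun x hx ↦ ?_⟩
  rw [← LieSubalgebra.mem_toSubmodule, b.coe_cartan_eq_span] at hx
  induction hx using Submodule.span_induction with
  | mem v hv => obtain ⟨j, rfl⟩ := hv; exact hω j
  | zero => simp
  | add v w _ _ hv hw => rw [map_add, hv, hw]; abel
  | smul t v _ hv => rw [map_smul, hv, smul_neg]

section DominantOrbit

open MvPolynomial

variable {K R σ : Type*} [Field K] [CommRing R] [Algebra K R]

/-- If a family of elements `u` of an algebra transforms affinely under derivations preserving an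
ideal `I`, with derivations realising all translations at the base point of `ker ε ⊇ I`,
then `u` is algebraically independent modulo `I`. -/
theorem MvPolynomial.eq_zero_of_aeval_mem_of_derivation [CharZero K] [Fintype σ] [DecidableEq σ]
    (I : Ideal R) (ε : R →ₐ[K] K) (hε : ∀ r ∈ I, ε r = 0) (D : σ → Derivation K R R)
    (hD : ∀ j, ∀ r ∈ I, D j r ∈ I) (u : σ → R) (hu : ∀ i, ε (u i) = 0) (a : σ → σ → σ → K)
    (hDu : ∀ j i, D j (u i) - (algebraMap K R (if i = j then 1 else 0) + ∑ k, a j i k • u k) ∈ I)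
    (Q : MvPolynomial σ K) (hQ : aeval u Q ∈ I) : Q = 0 := by
  let E (j : σ) : Derivation K (MvPolynomial σ K) (MvPolynomial σ K) :=
    mkDerivation K fun i ↦ C (if i = j then 1 else 0) + ∑ k, a j i k • X k
  have hE (j : σ) (P : MvPolynomial σ K) : D j (aeval u P) - aeval u (E j P) ∈ I := by
    induction P using MvPolynomial.induction_on with
    | C c => simp [E, ← MvPolynomial.algebraMap_eq]
    | add p q hp hq =>
      rw [map_add, map_add, map_add, map_add, add_sub_add_comm]
      exact I.add_mem hp hq
    | mul_X p i hp =>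
      have h1 : D j (aeval u (p * X i)) - aeval u (E j (p * X i)) =
          aeval u p * (D j (u i) - (algebraMap K R (if i = j then 1 else 0)
            + ∑ k, a j i k • u k)) + u i * (D j (aeval u p) - aeval u (E j p)) := by
        simp only [map_mul, aeval_X, Derivation.leibniz, smul_eq_mul, E, mkDerivation_X, map_add,
          aeval_C, map_sum, map_smul]
        ring
      rw [h1]
      exact I.add_mem (I.mul_mem_left _ (hDu j i)) (I.mul_mem_left _ hp)
  have hEQ (j : σ) (P : MvPolynomial σ K) : E j P = pderiv j P +
      ∑ i, (∑ k, a j i k • X k) * pderiv i P := by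
    induction P using MvPolynomial.induction_on with
    | C c => simp [E, ← MvPolynomial.algebraMap_eq]
    | add p q hp hq => simp only [map_add, hp, hq, mul_add, Finset.sum_add_distrib]; ring
    | mul_X p i hp =>
      have h1 : ∑ l, (∑ k, a j l k • X k) * pderiv l (p * X i) =
          p * (∑ k, a j i k • X k) + X i * ∑ l, (∑ k, a j l k • X k) * pderiv l p := by
        simp only [Derivation.leibniz, pderiv_X, Pi.single_apply, smul_eq_mul, mul_add,
          Finset.sum_add_distrib, Finset.mul_sum (s := Finset.univ) (a := X i)]
        congr 1
        · simp [mul_comm]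
        · exact Finset.sum_congr rfl fun l _ ↦ by ring
      have h2 : E j (X i) = C (if i = j then 1 else 0) + ∑ k, a j i k • X k := by
        simp [E]
      have h3 : pderiv j (X i) = C (R := K) (σ := σ) (if i = j then 1 else 0) := by
        rw [pderiv_X, Pi.single_apply]; split_ifs <;> simp
      rw [h1, Derivation.leibniz, Derivation.leibniz, hp, h2, h3]
      simp only [smul_eq_mul]
      ring
  have key (n : ℕ) : ∀ P : MvPolynomial σ K, aeval u P ∈ I → ∀ d, d.degree < n → P.coeff d = 0 := by
    induction n with
    | zero => simp
    | succ n ih =>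
      intro P hP d hd
      by_cases hd0 : d = 0
      · subst hd0
        have h2 := hε _ hP
        rw [MvPolynomial.comp_aeval_apply, _root_.funext hu, MvPolynomial.aeval_zero'] at h2
        simpa [MvPolynomial.constantCoeff_eq] using h2
      obtain ⟨j, hj⟩ : ∃ j, d j ≠ 0 := by
        by_contra! h
        exact hd0 (Finsupp.ext h)
      set d' := d - Finsupp.single j 1 with hd'
      have hdd : d = d' + Finsupp.single j 1 := by
        rw [hd', tsub_add_cancel_of_le]
        simpa [Nat.one_le_iff_ne_zero] using hj
      have hdeg : d'.degree < n := by
        rw [hdd, map_add, Finsupp.degree_single] at hd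
        omega
      have hmem : aeval u (E j P) ∈ I := by
        have := I.sub_mem (hD j _ hP) (hE j P)
        simpa using this
      have h4 := ih _ hmem d' hdeg
      have h5 : coeff d' (∑ i, (∑ k, a j i k • X k) * pderiv i P) = 0 := by
        rw [coeff_sum]
        refine Finset.sum_eq_zero fun i _ ↦ ?_
        rw [Finset.sum_mul, coeff_sum]
        refine Finset.sum_eq_zero fun k _ ↦ ?_
        rw [smul_mul_assoc, coeff_smul, coeff_X_mul']
        split_ifs with hk
        · rw [coeff_pderiv, ih P hP, zero_mul, smul_zero]
          have h6 : d' - Finsupp.single k 1 + Finsupp.single k 1 = d' := by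
            rw [tsub_add_cancel_of_le]
            simpa [Nat.one_le_iff_ne_zero] using hk
          have h7 := congrArg Finsupp.degree h6
          rw [map_add, Finsupp.degree_single] at h7 ⊢
          omega
        · simp
      rw [hEQ, coeff_add, h5, add_zero, coeff_pderiv, ← hdd] at h4
      exact (mul_eq_zero.mp h4).resolve_right (Nat.cast_add_one_ne_zero _)
  ext d
  exact key (d.degree + 1) Q hQ d (Nat.lt_succ_self _)

end DominantOrbit

section CommonPoint

open TensorProduct

variable {K : Type*} [Field K]

/-- Weak Nullstellensatz: a nontrivial algebra of finite type has a rational point. -/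
theorem Algebra.FiniteType.nonempty_algHom_of_isAlgClosed [IsAlgClosed K] (A : Type*)
    [CommRing A] [Algebra K A]
    [Algebra.FiniteType K A] [Nontrivial A] : Nonempty (A →ₐ[K] K) := by
  obtain ⟨m, hm⟩ := Ideal.exists_maximal A
  let : Field (A ⧸ m) := Ideal.Quotient.field m
  have : Module.Finite K (A ⧸ m) := finite_of_finite_type_of_isJacobsonRing K (A ⧸ m)
  let e : K ≃ₐ[K] (A ⧸ m) := AlgEquiv.ofBijective (Algebra.ofId K (A ⧸ m))
    (IsAlgClosed.algebraMap_bijective_of_isIntegral (k := K))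
  exact ⟨(e.symm : (A ⧸ m) →ₐ[K] K).comp (Ideal.Quotient.mkₐ K m)⟩

theorem MvPolynomial.exists_isPrime_of_aeval_mem_imp {R σ : Type*} [CommRing R] [Algebra K R]
    (I : Ideal R) (f : σ → R) (hf : ∀ Q : MvPolynomial σ K, MvPolynomial.aeval f Q ∈ I → Q = 0) :
    ∃ P : Ideal R, P.IsPrime ∧ I ≤ P ∧
      ∀ Q : MvPolynomial σ K, MvPolynomial.aeval f Q ∈ P → Q = 0 := by
  let g : MvPolynomial σ K →+* R ⧸ I := (Ideal.Quotient.mk I).comp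
    (MvPolynomial.aeval f : MvPolynomial σ K →ₐ[K] R).toRingHom
  have hg : Function.Injective g := by
    rw [injective_iff_map_eq_zero]
    intro Q hQ
    exact hf Q (Ideal.Quotient.eq_zero_iff_mem.mp hQ)
  obtain ⟨p, hp, hpc⟩ := Ideal.exists_comap_eq_of_mem_minimalPrimes_of_injective hg ⊥
    (by rw [IsDomain.minimalPrimes_eq_singleton_bot]; rfl)
  refine ⟨p.comap (Ideal.Quotient.mk I), hp.comap _, fun x hx ↦ ?_, fun Q hQ ↦ ?_⟩
  · rw [Ideal.mem_comap, Ideal.Quotient.eq_zero_iff_mem.mpr hx]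
    exact p.zero_mem
  · have : Q ∈ p.comap g := hQ
    rwa [hpc, Ideal.mem_bot] at this

/-- Two dominant families of functions on affine varieties have a common value. -/
theorem MvPolynomial.exists_algHom_apply_eq [IsAlgClosed K] {R σ : Type*} [CommRing R] [Algebra K R]
    [Algebra.FiniteType K R] (I J : Ideal R) (f g : σ → R)
    (hf : ∀ Q : MvPolynomial σ K, MvPolynomial.aeval f Q ∈ I → Q = 0)
    (hg : ∀ Q : MvPolynomial σ K, MvPolynomial.aeval g Q ∈ J → Q = 0) :
    ∃ p q : R →ₐ[K] K, (∀ r ∈ I, p r = 0) ∧ (∀ r ∈ J, q r = 0) ∧ ∀ i, p (f i) = q (g i) := by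
  obtain ⟨P, hP, hIP, hPf⟩ := exists_isPrime_of_aeval_mem_imp I f hf
  obtain ⟨P', hP', hJP, hPg⟩ := exists_isPrime_of_aeval_mem_imp J g hg
  let a : MvPolynomial σ K →ₐ[K] R ⧸ P := (Ideal.Quotient.mkₐ K P).comp (MvPolynomial.aeval f)
  let b : MvPolynomial σ K →ₐ[K] R ⧸ P' := (Ideal.Quotient.mkₐ K P').comp (MvPolynomial.aeval g)
  algebraize_only [a.toRingHom, b.toRingHom]
  have : IsScalarTower K (MvPolynomial σ K) (R ⧸ P) := .of_algebraMap_eq' a.comp_algebraMap.symm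
  have : IsScalarTower K (MvPolynomial σ K) (R ⧸ P') := .of_algebraMap_eq' b.comp_algebraMap.symm
  have hn : Nontrivial ((R ⧸ P) ⊗[MvPolynomial σ K] (R ⧸ P')) := by
    refine Algebra.TensorProduct.nontrivial_of_algebraMap_injective_of_isDomain _ _ _ ?_ ?_
    · rw [injective_iff_map_eq_zero]
      exact fun Q hQ ↦ hPf Q (Ideal.Quotient.eq_zero_iff_mem.mp hQ)
    · rw [injective_iff_map_eq_zero]
      exact fun Q hQ ↦ hPg Q (Ideal.Quotient.eq_zero_iff_mem.mp hQ)
  have : Algebra.FiniteType (MvPolynomial σ K) (R ⧸ P') :=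
    Algebra.FiniteType.of_restrictScalars_finiteType K _ _
  have : Algebra.FiniteType K ((R ⧸ P) ⊗[MvPolynomial σ K] (R ⧸ P')) :=
    Algebra.FiniteType.trans (S := R ⧸ P) inferInstance inferInstance
  obtain ⟨c⟩ := Algebra.FiniteType.nonempty_algHom_of_isAlgClosed (K := K)
    ((R ⧸ P) ⊗[MvPolynomial σ K] (R ⧸ P'))
  let iL : (R ⧸ P) →ₐ[K] (R ⧸ P) ⊗[MvPolynomial σ K] (R ⧸ P') := Algebra.TensorProduct.includeLeft
  let iR : (R ⧸ P') →ₐ[K] (R ⧸ P) ⊗[MvPolynomial σ K] (R ⧸ P') :=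
    Algebra.TensorProduct.includeRight.restrictScalars K
  refine ⟨(c.comp iL).comp (Ideal.Quotient.mkₐ K P), (c.comp iR).comp (Ideal.Quotient.mkₐ K P'),
    fun r hr ↦ ?_, fun r hr ↦ ?_, fun i ↦ ?_⟩
  · simp [Ideal.Quotient.eq_zero_iff_mem.mpr (hIP hr)]
  · simp [Ideal.Quotient.eq_zero_iff_mem.mpr (hJP hr)]
  · have h1 : algebraMap (MvPolynomial σ K) (R ⧸ P) (X i) = Ideal.Quotient.mk P (f i) := by
      change a (X i) = _
      simp [a]
    have h2 : algebraMap (MvPolynomial σ K) (R ⧸ P') (X i) = Ideal.Quotient.mk P' (g i) := by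
      change b (X i) = _
      simp [b]
    have h3 : iL (Ideal.Quotient.mk P (f i)) = iR (Ideal.Quotient.mk P' (g i)) := by
      rw [← h1, ← h2]
      exact Algebra.TensorProduct.tmul_one_eq_one_tmul (X i)
    simp [h3]

end CommonPoint

namespace LieAlgebra.GenericEndomorphism

open TensorProduct Module

variable {K L ι : Type*} [Field K] [LieRing L] [LieAlgebra K L]

/-- Base change of a linear form. -/
noncomputable def coeffForm (R : Type*) [CommRing R] [Algebra K R] (l : Dual K L) :
    R ⊗[K] L →ₗ[K] R :=
  TensorProduct.lift ((LinearMap.lsmul K R).flip.compl₂ l)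

section

variable {R : Type*} [CommRing R] [Algebra K R]

@[simp]
theorem coeffForm_tmul (l : Dual K L) (r : R) (x : L) :
    coeffForm R l (r ⊗ₜ x) = l x • r := by
  simp [coeffForm]

theorem coeffForm_lie (l : Dual K L) (y : L) (t : R ⊗[K] L) :
    coeffForm R l ⁅(1 : R) ⊗ₜ[K] y, t⁆ = coeffForm R (l ∘ₗ (ad K L y : L →ₗ[K] L)) t := by
  induction t with
  | zero => simp
  | add t t' h h' => rw [lie_add, map_add, map_add, h, h']
  | tmul r x => simp [ExtendScalars.bracket_tmul]

theorem coeffForm_rTensor (l : Dual K L) (D : R →ₗ[K] R) (t : R ⊗[K] L) :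
    coeffForm R l (D.rTensor L t) = D (coeffForm R l t) := by
  induction t with
  | zero => simp
  | add t t' h h' => simp only [map_add, h, h']
  | tmul r x => simp

theorem coeffForm_add (l m : Dual K L) (t : R ⊗[K] L) :
    coeffForm R (l + m) t = coeffForm R l t + coeffForm R m t := by
  induction t with
  | zero => simp
  | add t t' h h' => simp only [map_add, h, h']; ring
  | tmul r x => simp [add_smul]

theorem coeffForm_smul (c : K) (l : Dual K L) (t : R ⊗[K] L) :
    coeffForm R (c • l) t = c • coeffForm R l t := by
  induction t with
  | zero => simp
  | add t t' h h' => simp only [map_add, h, h', smul_add]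
  | tmul r x => simp [mul_smul]

/-- `coeffForm` as a linear function of the form. -/
noncomputable def coeffFormFlip (t : R ⊗[K] L) : Dual K L →ₗ[K] R where
  toFun l := coeffForm R l t
  map_add' l m := coeffForm_add l m t
  map_smul' c l := coeffForm_smul c l t

theorem coeffFormFlip_apply (l : Dual K L) (t : R ⊗[K] L) :
    coeffFormFlip t l = coeffForm R l t := rfl

theorem rTensor_lie (D : Derivation K R R) (t t' : R ⊗[K] L) :
    (D : R →ₗ[K] R).rTensor L ⁅t, t'⁆ =
      ⁅(D : R →ₗ[K] R).rTensor L t, t'⁆ + ⁅t, (D : R →ₗ[K] R).rTensor L t'⁆ := by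
  induction t with
  | zero => simp
  | add t₁ t₂ h₁ h₂ => simp only [add_lie, map_add, h₁, h₂]; abel
  | tmul r x =>
    induction t' with
    | zero => simp
    | add t₁ t₂ h₁ h₂ => simp only [lie_add, map_add, h₁, h₂]; abel
    | tmul r' x' =>
      simp [ExtendScalars.bracket_tmul, TensorProduct.add_tmul, add_comm, mul_comm]

/-- Specialisation of scalars. -/
noncomputable def specialize (p : R →ₐ[K] K) : R ⊗[K] L →ₗ[K] L :=
  (TensorProduct.lid K L : K ⊗[K] L →ₗ[K] L) ∘ₗ p.toLinearMap.rTensor L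

@[simp]
theorem specialize_tmul (p : R →ₐ[K] K) (r : R) (x : L) :
    specialize p (r ⊗ₜ[K] x) = p r • x := by
  simp [specialize]

theorem specialize_lie (p : R →ₐ[K] K) (t t' : R ⊗[K] L) :
    specialize p ⁅t, t'⁆ = ⁅specialize p t, specialize p t'⁆ := by
  induction t with
  | zero => simp
  | add t₁ t₂ h₁ h₂ => simp only [add_lie, map_add, h₁, h₂]
  | tmul r x =>
    induction t' with
    | zero => simp
    | add t₁ t₂ h₁ h₂ => simp only [lie_add, map_add, h₁, h₂]
    | tmul r' x' => simp [ExtendScalars.bracket_tmul, smul_smul, mul_comm]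

theorem lie_sub_lie (u t t' : R ⊗[K] L) : ⁅u, t⁆ - ⁅u, t'⁆ = ⁅u, t - t'⁆ :=
  (lie_sub u t t').symm

theorem apply_specialize (l : Dual K L) (p : R →ₐ[K] K) (t : R ⊗[K] L) :
    l (specialize p t) = p (coeffForm R l t) := by
  induction t with
  | zero => simp
  | add t t' h h' => simp only [map_add, h, h']
  | tmul r x => simp [mul_comm]

end

variable [Fintype ι] (b : Module.Basis ι K L)

/-- The linear map whose matrix has independent indeterminates as entries. -/
noncomputable def genericMap : L →ₗ[K] MvPolynomial (ι × ι) K ⊗[K] L :=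
  b.constr K fun j ↦ ∑ i, MvPolynomial.X (i, j) ⊗ₜ b i

/-- The infinitesimal left translation by `y`. -/
noncomputable def translation (y : L) :
    Derivation K (MvPolynomial (ι × ι) K) (MvPolynomial (ι × ι) K) :=
  MvPolynomial.mkDerivation K fun p ↦ ∑ k, b.repr ⁅y, b k⁆ p.1 • MvPolynomial.X (k, p.2)

theorem rTensor_translation_genericMap (x y : L) :
    (translation b y : MvPolynomial (ι × ι) K →ₗ[K] MvPolynomial (ι × ι) K).rTensor L
      (genericMap b x) = ⁅(1 : MvPolynomial (ι × ι) K) ⊗ₜ[K] y, genericMap b x⁆ := by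
  have : (translation b y : MvPolynomial (ι × ι) K →ₗ[K] MvPolynomial (ι × ι) K).rTensor L ∘ₗ
      genericMap b = (ad K (MvPolynomial (ι × ι) K ⊗[K] L) (1 ⊗ₜ y) :
        _ →ₗ[K] MvPolynomial (ι × ι) K ⊗[K] L) ∘ₗ genericMap b := by
    refine b.ext fun j ↦ ?_
    simp only [LinearMap.comp_apply, genericMap, Basis.constr_basis, map_sum,
      LinearMap.rTensor_tmul, Derivation.coeFn_coe, translation, MvPolynomial.mkDerivation_X,
      ad_apply, ExtendScalars.bracket_tmul, one_mul, TensorProduct.sum_tmul]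
    rw [Finset.sum_comm]
    refine Finset.sum_congr rfl fun k _ ↦ ?_
    conv_rhs => rw [← b.sum_repr ⁅y, b k⁆, TensorProduct.tmul_sum]
    simp [TensorProduct.smul_tmul]
  exact LinearMap.congr_fun this x

/-- The ideal of endomorphisms fixing `S` and satisfying the linear conditions `W` at `e`. -/
noncomputable def relations (S : Set L) (W : Set (Dual K L)) (e : L) :
    Ideal (MvPolynomial (ι × ι) K) :=
  Ideal.span ({r | ∃ l x x', r = coeffForm _ l (⁅genericMap b x, genericMap b x'⁆ -
    genericMap b ⁅x, x'⁆)} ∪ {r | ∃ l, ∃ s ∈ S, r = coeffForm _ l (genericMap b s - 1 ⊗ₜ s)} ∪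
    {r | ∃ l ∈ W, r = coeffForm _ l (genericMap b e)})

theorem translation_mem_relations (S : Set L) (W : Set (Dual K L)) (e y : L)
    (hS : ∀ s ∈ S, ⁅y, s⁆ = 0) (hW : ∀ l ∈ W, l ∘ₗ (ad K L y : L →ₗ[K] L) ∈ W)
    {r : MvPolynomial (ι × ι) K} (hr : r ∈ relations b S W e) :
    translation b y r ∈ relations b S W e := by
  have hD (l : Dual K L) (t : MvPolynomial (ι × ι) K ⊗[K] L) :
      translation b y (coeffForm _ l t) = coeffForm _ l ((translation b y :
        MvPolynomial (ι × ι) K →ₗ[K] MvPolynomial (ι × ι) K).rTensor L t) :=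
    (coeffForm_rTensor l (translation b y : MvPolynomial (ι × ι) K →ₗ[K] _) t).symm
  induction hr using Submodule.span_induction with
  | zero => simp
  | add r r' _ _ h h' => rw [map_add]; exact add_mem h h'
  | smul c r hr h =>
    rw [smul_eq_mul, Derivation.leibniz]
    exact add_mem (Ideal.mul_mem_left _ _ h) (by
      rw [smul_eq_mul]; exact Ideal.mul_mem_right _ _ hr)
  | mem r hr =>
    rcases hr with (⟨l, x, x', rfl⟩ | ⟨l, s, hs, rfl⟩) | ⟨l, hl, rfl⟩
    · rw [hD, map_sub, rTensor_lie]
      simp only [rTensor_translation_genericMap]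
      rw [← leibniz_lie, lie_sub_lie, coeffForm_lie]
      exact Ideal.subset_span (.inl (.inl ⟨_, x, x', rfl⟩))
    · have h0 : (translation b y : MvPolynomial (ι × ι) K →ₗ[K]
          MvPolynomial (ι × ι) K).rTensor L (1 ⊗ₜ[K] s) =
            ⁅(1 : MvPolynomial (ι × ι) K) ⊗ₜ[K] y, (1 : MvPolynomial (ι × ι) K) ⊗ₜ[K] s⁆ := by
        simp [ExtendScalars.bracket_tmul, hS s hs]
      rw [hD, map_sub, rTensor_translation_genericMap, h0, lie_sub_lie, coeffForm_lie]
      exact Ideal.subset_span (.inl (.inr ⟨_, s, hs, rfl⟩))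
    · rw [hD, rTensor_translation_genericMap, coeffForm_lie]
      exact Ideal.subset_span (.inr ⟨_, hW l hl, rfl⟩)

theorem exists_lieHom_of_relations (S : Set L) (W : Set (Dual K L)) (e : L)
    (p : MvPolynomial (ι × ι) K →ₐ[K] K) (hp : ∀ r ∈ relations b S W e, p r = 0) :
    ∃ f : L →ₗ⁅K⁆ L, (∀ s ∈ S, f s = s) ∧ (∀ l ∈ W, l (f e) = 0) ∧
      ∀ l : Dual K L, l (f e) = p (coeffForm _ l (genericMap b e)) := by
  refine ⟨{ toLinearMap := specialize p ∘ₗ genericMap b, map_lie' := ?_ }, fun s hs ↦ ?_,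
    fun l hl ↦ ?_, fun l ↦ apply_specialize l p _⟩
  · intro x y
    have h : ∀ l : Dual K L, l (specialize p (⁅genericMap b x, genericMap b y⁆ -
        genericMap b ⁅x, y⁆)) = 0 := fun l ↦ by
      rw [apply_specialize]
      exact hp _ (Ideal.subset_span (.inl (.inl ⟨l, x, y, rfl⟩)))
    rw [Module.forall_dual_apply_eq_zero_iff, map_sub, sub_eq_zero, specialize_lie] at h
    exact h.symm
  · have h : ∀ l : Dual K L, l (specialize p (genericMap b s - 1 ⊗ₜ s)) = 0 := fun l ↦ by
      rw [apply_specialize]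
      exact hp _ (Ideal.subset_span (.inl (.inr ⟨l, s, hs, rfl⟩)))
    rw [Module.forall_dual_apply_eq_zero_iff, map_sub, sub_eq_zero] at h
    exact h.trans (by simp)
  · change l (specialize p (genericMap b e)) = 0
    rw [apply_specialize]
    exact hp _ (Ideal.subset_span (.inr ⟨l, hl, rfl⟩))

open Classical in
/-- Evaluation of the entries at the identity matrix. -/
noncomputable def evalOne : MvPolynomial (ι × ι) K →ₐ[K] K :=
  MvPolynomial.aeval fun p : ι × ι ↦ if p.1 = p.2 then 1 else 0

theorem specialize_evalOne (x : L) : specialize evalOne (genericMap b x) = x := by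
  classical
  have : specialize evalOne ∘ₗ genericMap b = LinearMap.id := b.ext fun j ↦ by
    simp [genericMap, evalOne]
  exact LinearMap.congr_fun this x

theorem evalOne_eq_zero (S : Set L) (W : Set (Dual K L)) (e : L) (hW : ∀ l ∈ W, l e = 0)
    {r : MvPolynomial (ι × ι) K} (hr : r ∈ relations b S W e) : evalOne r = 0 := by
  induction hr using Submodule.span_induction with
  | zero => simp
  | add r r' _ _ h h' => simp [h, h']
  | smul c r hr h => simp [h]
  | mem r hr =>
    rcases hr with (⟨l, x, x', rfl⟩ | ⟨l, s, hs, rfl⟩) | ⟨l, hl, rfl⟩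
    · rw [← apply_specialize, map_sub, specialize_lie]
      simp [specialize_evalOne]
    · rw [← apply_specialize, map_sub]
      simp [specialize_evalOne]
    · rw [← apply_specialize, specialize_evalOne, hW l hl]

/-- The coordinates of the generic image of `e` along `V` are algebraically independent modulo the
relations, as soon as `e` has a dense orbit infinitesimally. -/
theorem eq_zero_of_aeval_mem_relations [CharZero K] {σ : Type*} [Fintype σ] [DecidableEq σ]
    (S : Set L) (V : Submodule K L) (v : Module.Basis σ K V) (P : L →ₗ[K] V)
    (hP : ∀ x : V, P x = x) (M : Set L) (hMS : ∀ y ∈ M, ∀ s ∈ S, ⁅y, s⁆ = 0)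
    (hMV : ∀ y ∈ M, ∀ x ∈ V, ⁅y, x⁆ ∈ V) (e : L) (he : e ∈ V) (hMe : ∀ x ∈ V, ∃ y ∈ M, ⁅y, e⁆ = x)
    (Q : MvPolynomial σ K)
    (hQ : MvPolynomial.aeval (fun i ↦ coeffForm _ (v.coord i ∘ₗ P) (genericMap b e)) Q ∈
      relations b S {l | ∀ x ∈ V, l x = 0} e) : Q = 0 := by
  set W : Set (Dual K L) := {l | ∀ x ∈ V, l x = 0}
  have hW (y) (hy : y ∈ M) : ∀ l ∈ W, l ∘ₗ (ad K L y : L →ₗ[K] L) ∈ W :=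
    fun l hl x hx ↦ hl _ (hMV y hy x hx)
  choose y hyM hye using fun j ↦ hMe (v j) (v j).2
  let c (i : σ) : K := v.coord i (P e)
  let u (i : σ) : MvPolynomial (ι × ι) K :=
    coeffForm _ (v.coord i ∘ₗ P) (genericMap b e) - MvPolynomial.C (c i)
  have hsum (x : L) (hx : x ∈ V) : ∑ k, v.coord k (P x) • (v k : L) = x := by
    have h1 : ((∑ k, v.repr (P x) k • v k : V) : L) = x := by
      rw [v.sum_repr, hP ⟨x, hx⟩]
    simpa only [Submodule.coe_sum, Submodule.coe_smul, v.coord_apply] using h1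
  have key (Q' : MvPolynomial σ K) (hQ' : MvPolynomial.aeval u Q' ∈ relations b S W e) :
      Q' = 0 := by
    refine MvPolynomial.eq_zero_of_aeval_mem_of_derivation (relations b S W e) evalOne
      (fun r hr ↦ evalOne_eq_zero b S W e (fun l hl ↦ hl e he) hr) (fun j ↦ translation b (y j))
      (fun j r hr ↦ translation_mem_relations b S W e (y j) (hMS _ (hyM j)) (hW _ (hyM j)) hr)
      u (fun i ↦ ?_) (fun j i k ↦ v.coord i (P ⁅y j, (v k : L)⁆)) (fun j i ↦ ?_) Q' hQ'
    · rw [map_sub, ← apply_specialize, specialize_evalOne]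
      simp [evalOne, c]
    · set m : Dual K L := (v.coord i ∘ₗ P) ∘ₗ (ad K L (y j) : L →ₗ[K] L) with hm
      have h1 : translation b (y j) (u i) = coeffForm _ m (genericMap b e) := by
        have h := coeffForm_rTensor (v.coord i ∘ₗ P)
          (translation b (y j) : MvPolynomial (ι × ι) K →ₗ[K] _) (genericMap b e)
        rw [rTensor_translation_genericMap, coeffForm_lie] at h
        rw [map_sub, ← MvPolynomial.algebraMap_eq, Derivation.map_algebraMap, sub_zero]
        exact h.symm
      have hmx (x : L) (hx : x ∈ V) : m x = ∑ k, v.coord k (P x) * m (v k) := by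
        conv_lhs => rw [← hsum x hx]
        rw [map_sum]
        exact Finset.sum_congr rfl fun k _ ↦ by rw [map_smul, smul_eq_mul]
      have hmW : m - ∑ k, m (v k) • (v.coord k ∘ₗ P) ∈ W := by
        intro x hx
        rw [LinearMap.sub_apply, hmx x hx, sub_eq_zero, LinearMap.sum_apply]
        exact Finset.sum_congr rfl fun k _ ↦ mul_comm _ _
      have hme : ∑ k, m (v k) * c k = if i = j then 1 else 0 := by
        simp_rw [mul_comm (m _)]
        rw [← hmx e he, hm, LinearMap.comp_apply, LinearMap.comp_apply,
          ad_apply, hye, hP]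
        simp [Finsupp.single_apply, eq_comm]
      have h2 : coeffForm _ (m - ∑ k, m (v k) • (v.coord k ∘ₗ P)) (genericMap b e) ∈
          relations b S W e := Ideal.subset_span (.inr ⟨_, hmW, rfl⟩)
      convert h2 using 1
      rw [h1, ← hme, ← coeffFormFlip_apply, ← coeffFormFlip_apply, map_sub, map_sum, map_sum,
        ← Finset.sum_add_distrib]
      congr 1
      refine Finset.sum_congr rfl fun k _ ↦ ?_
      rw [map_smul, coeffFormFlip_apply, map_mul]
      change _ + m (v k) • _ = _
      rw [smul_sub, MvPolynomial.algebraMap_eq, ← MvPolynomial.smul_eq_C_mul]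
      abel
  have hu : MvPolynomial.aeval u (MvPolynomial.aeval
      (fun i ↦ MvPolynomial.X i + MvPolynomial.C (c i)) Q : MvPolynomial σ K) =
      MvPolynomial.aeval (fun i ↦ coeffForm _ (v.coord i ∘ₗ P) (genericMap b e)) Q := by
    rw [MvPolynomial.comp_aeval_apply]
    simp [u]
  have h0 := congrArg (MvPolynomial.aeval
    (fun i ↦ (MvPolynomial.X i - MvPolynomial.C (c i) : MvPolynomial σ K))) (key _ (hu ▸ hQ))
  rw [MvPolynomial.comp_aeval_apply] at h0
  simpa using h0

/-- Two vectors of `V` with infinitesimally dense orbits have a common image under endomorphisms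
fixing `S`. -/
theorem exists_lieHom_apply_eq [CharZero K] [IsAlgClosed K] [FiniteDimensional K L]
    (S : Set L) (V : Submodule K L) (M : Set L) (hMS : ∀ y ∈ M, ∀ s ∈ S, ⁅y, s⁆ = 0)
    (hMV : ∀ y ∈ M, ∀ x ∈ V, ⁅y, x⁆ ∈ V) {e e' : L} (he : e ∈ V) (he' : e' ∈ V)
    (hMe : ∀ x ∈ V, ∃ y ∈ M, ⁅y, e⁆ = x) (hMe' : ∀ x ∈ V, ∃ y ∈ M, ⁅y, e'⁆ = x) :
    ∃ f g : L →ₗ⁅K⁆ L, (∀ s ∈ S, f s = s) ∧ (∀ s ∈ S, g s = s) ∧ f e = g e' := by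
  classical
  let b := Module.finBasis K L
  let v := Module.finBasis K V
  obtain ⟨P, hP⟩ := LinearMap.exists_leftInverse_of_injective V.subtype V.ker_subtype
  have hP' (x : V) : P x = x := LinearMap.congr_fun hP x
  obtain ⟨p, q, hp, hq, hpq⟩ := MvPolynomial.exists_algHom_apply_eq _ _ _ _
    (eq_zero_of_aeval_mem_relations b S V v P hP' M hMS hMV e he hMe)
    (eq_zero_of_aeval_mem_relations b S V v P hP' M hMS hMV e' he' hMe')
  obtain ⟨f, hf, hfV, hfe⟩ := exists_lieHom_of_relations b S _ e p hp
  obtain ⟨g, hg, hgV, hge⟩ := exists_lieHom_of_relations b S _ e' q hq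
  refine ⟨f, g, hf, hg, ?_⟩
  have hmem (x : L) (hx : ∀ l : Dual K L, (∀ z ∈ V, l z = 0) → l x = 0) : x ∈ V := by
    by_contra h
    obtain ⟨l, hl, hlV⟩ := Submodule.exists_dual_map_eq_bot_of_notMem h inferInstance
    refine hl (hx l fun z hz ↦ ?_)
    have : l z ∈ V.map l := Submodule.mem_map_of_mem hz
    rwa [hlV, Submodule.mem_bot] at this
  have hfeV := hmem _ hfV
  have hgeV := hmem _ hgV
  have h : P (f e) = P (g e') := v.ext_elem fun i ↦ by
    exact ((hfe (v.coord i ∘ₗ P)).trans (hpq i)).trans (hge (v.coord i ∘ₗ P)).symm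
  rw [hP' ⟨f e, hfeV⟩, hP' ⟨g e', hgeV⟩] at h
  exact congrArg Subtype.val h

end LieAlgebra.GenericEndomorphism

namespace Module.End

variable {K V : Type*} [Field K] [AddCommGroup V] [Module K V]

theorem isNilpotent_of_forall_eigenvalue_eq_zero [FiniteDimensional K V] [IsAlgClosed K]
    (f : End K V)
    (hf : ∀ (μ : K) (v : V), v ≠ 0 → f v = μ • v → μ = 0) : IsNilpotent f := by
  have h1 (μ : K) (hμ : μ ≠ 0) : f.maxGenEigenspace μ = ⊥ := by
    have h2 : f.eigenspace μ = ⊥ := by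
      rw [Submodule.eq_bot_iff]
      intro v hv
      by_contra hv0
      exact hμ (hf μ v hv0 (mem_eigenspace_iff.mp hv))
    by_contra h
    exact HasUnifEigenvalue.lt (k := ⊤) zero_lt_one h h2
  have h3 : f.maxGenEigenspace 0 = ⊤ := by
    rw [← f.iSup_maxGenEigenspace_eq_top]
    refine le_antisymm (le_iSup (fun μ ↦ f.maxGenEigenspace μ) 0) (iSup_le fun μ ↦ ?_)
    by_cases hμ : μ = 0
    · rw [hμ]
    · simp [h1 μ hμ]
  refine ⟨finrank K V, LinearMap.ext fun v ↦ ?_⟩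
  have hv : v ∈ f.maxGenEigenspace 0 := h3 ▸ Submodule.mem_top
  rw [maxGenEigenspace_eq_genEigenspace_finrank, mem_genEigenspace_nat] at hv
  simpa using hv

/-- An endomorphism shifting the eigenvalues of another one is nilpotent. -/
theorem isNilpotent_of_commutator_eq_smul [FiniteDimensional K V] [CharZero K]
    {f g : End K V} {c : K} (hc : c ≠ 0)
    (h : g * f - f * g = c • f) : IsNilpotent f := by
  by_contra hf
  have hf' (n : ℕ) : f ^ n ≠ 0 := fun h ↦ hf ⟨n, h⟩
  let D : End K (End K V) := LinearMap.mulLeft K g - LinearMap.mulRight K g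
  have hD (n : ℕ) : D (f ^ n) = (n * c) • f ^ n := by
    induction n with
    | zero => simp [D]
    | succ n ih =>
      have h1 : D (f ^ (n + 1)) = D (f ^ n) * f + f ^ n * (g * f - f * g) := by
        simp [D, pow_succ]
        noncomm_ring
      rw [h1, ih, h, pow_succ]
      simp [add_mul, add_smul]
  have hev (n : ℕ) : D.HasEigenvalue (n * c) :=
    hasEigenvalue_of_hasEigenvector ⟨mem_eigenspace_iff.mpr (hD n), hf' n⟩
  have hinj : Function.Injective fun n : ℕ ↦ (n * c : K) := fun m n hmn ↦ by
    simpa [hc] using hmn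
  exact Set.infinite_of_injective_forall_mem hinj hev D.finite_hasEigenvalue

/-- The Kleinecke–Shirokov theorem: a commutator commuting with one of its nilpotent factors is
nilpotent. -/
theorem _root_.IsNilpotent.commutator_of_commute {A : Type*} [Ring A] [Algebra ℚ A] {a b : A}
    (ha : IsNilpotent a) (h : Commute a (a * b - b * a)) : IsNilpotent (a * b - b * a) := by
  set c := a * b - b * a with hc
  let D : End ℚ A := LinearMap.mulLeft ℚ a - LinearMap.mulRight ℚ a
  have hDmul (x y : A) : D (x * y) = D x * y + x * D y := by
    simp [D]
    noncomm_ring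
  have hDb : D b = c := by simp [D, hc]
  have hDc : D c = 0 := by simp [D, h.eq]
  have hpow (m : ℕ) (x : A) : (D ^ (m + 1)) (x * b) =
      (D ^ (m + 1)) x * b + ((m + 1 : ℕ) : ℚ) • ((D ^ m) x * c) := by
    induction m with
    | zero => simp [hDmul, hDb]
    | succ m ih =>
      rw [pow_succ', End.mul_apply, ih, map_add, map_smul, hDmul, hDmul, hDb, hDc, mul_zero,
        add_zero, ← End.mul_apply, ← pow_succ', ← End.mul_apply, ← pow_succ', add_assoc,
        Nat.cast_succ (m + 1), add_comm ((m + 1 : ℕ) : ℚ), add_smul, one_smul]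
  have hDpow (k : ℕ) : (D ^ (k + 1)) (b ^ k) = 0 ∧ (D ^ k) (b ^ k) = (k.factorial : ℚ) • c ^ k := by
    induction k with
    | zero => simp [D]
    | succ k ih =>
      have h1 : (D ^ (k + 1)) (b ^ (k + 1)) = ((k + 1).factorial : ℚ) • c ^ (k + 1) := by
        rw [pow_succ b, hpow, ih.1, ih.2, zero_mul, zero_add, smul_mul_assoc, smul_smul,
          ← pow_succ, Nat.factorial_succ]
        push_cast
        rfl
      refine ⟨?_, h1⟩
      have h2 : (D ^ (k + 2)) (b ^ k) = 0 := by
        rw [pow_succ', End.mul_apply, ih.1, map_zero]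
      rw [pow_succ b, hpow, h2, ih.1]
      simp
  have hDnil : IsNilpotent D := by
    refine Commute.isNilpotent_sub ?_ ?_ ?_
    · exact LinearMap.commute_mulLeft_right a a
    · exact (LinearMap.isNilpotent_mulLeft_iff ℚ a).mpr ha
    · exact (LinearMap.isNilpotent_mulRight_iff ℚ a).mpr ha
  obtain ⟨k, hk⟩ := hDnil
  refine ⟨k, ?_⟩
  have := (hDpow k).2
  rw [hk, LinearMap.zero_apply] at this
  exact (smul_eq_zero.mp this.symm).resolve_left (by exact_mod_cast k.factorial_ne_zero)

theorem trace_mul_eq_zero_of_commute_commutator [FiniteDimensional K V] [IsAlgClosed K] [CharZero K]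
    {a b : End K V}
    (ha : IsNilpotent a) (h : Commute a (a * b - b * a)) : LinearMap.trace K V (a * b) = 0 := by
  set c := a * b - b * a with hc
  have hcn : IsNilpotent c := by
    let := DivisionRing.toRatAlgebra (R := K)
    let : Algebra ℚ (End K V) := Algebra.compHom _ (algebraMap ℚ K)
    exact ha.commutator_of_commute h
  have hba (i : ℕ) : a * b * a ^ i = a ^ (i + 1) * b - (i : K) • (a ^ i * c) := by
    induction i with
    | zero => simp
    | succ i ih =>
      have h1 : b * a = a * b - c := by rw [hc]; abel
      rw [pow_succ, ← mul_assoc, ih, sub_mul, smul_mul_assoc, mul_assoc _ c a, ← h.eq,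
        mul_assoc _ b, h1, mul_sub, ← mul_assoc, ← mul_assoc, ← pow_succ, ← pow_succ]
      push_cast
      rw [add_smul, one_smul]
      abel
  refine (LinearMap.isNilpotent_trace_of_isNilpotent
    (isNilpotent_of_forall_eigenvalue_eq_zero _ fun μ v hv0 hv ↦ ?_)).eq_zero
  by_contra hμ
  have hrange (i : ℕ) : ∃ w, (a ^ i) w = v := by
    induction i with
    | zero => exact ⟨v, by simp⟩
    | succ i ih =>
      obtain ⟨w, hw⟩ := ih
      have h1 : μ • v + (i : K) • c v = (a ^ (i + 1)) (b w) := by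
        have h2 := LinearMap.congr_fun (hba i) w
        have h3 : (a ^ i * c) w = c v := by
          rw [(h.pow_left i).eq, End.mul_apply, hw]
        rw [End.mul_apply, hw, hv, LinearMap.sub_apply, LinearMap.smul_apply, h3,
          End.mul_apply] at h2
        rw [h2, sub_add_cancel]
      have hunit : IsUnit (algebraMap K (End K V) μ + (i : K) • c) := by
        refine IsNilpotent.isUnit_add_left_of_commute (hcn.smul _) ?_ (Algebra.commutes μ _).symm
        exact (isUnit_iff_ne_zero.mpr hμ).map (algebraMap K (End K V))
      obtain ⟨U, hU⟩ := hunit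
      have hga : Commute a ((U⁻¹ : (End K V)ˣ) : End K V) :=
        by
        refine Commute.units_inv_right ?_
        rw [hU]
        exact Commute.add_right (Algebra.commutes μ a).symm (h.smul_right _)
      refine ⟨((U⁻¹ : (End K V)ˣ) : End K V) (b w), ?_⟩
      rw [← End.mul_apply, (hga.pow_left _).eq, End.mul_apply, ← h1]
      have h4 := LinearMap.congr_fun U.inv_mul v
      rwa [hU] at h4
  obtain ⟨k, hk⟩ := ha
  obtain ⟨w, hw⟩ := hrange k
  exact hv0 (by rw [← hw, hk, LinearMap.zero_apply])

theorem eq_zero_of_commutator_eq_neg_two_smul [CharZero K] {e f h : End K V} (he : IsNilpotent e)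
    (hef : e * f - f * e = h) (hhe : h * e - e * h = (2 : K) • e) {u : V} (hu : e u = 0)
    (hhu : h u = (-2 : K) • u) : u = 0 := by
  have hhe' (i : ℕ) : h * e ^ i = e ^ i * h + (2 * i : K) • e ^ i := by
    induction i with
    | zero => simp
    | succ i ih =>
      have h1 : h * e = e * h + (2 : K) • e := by rw [← hhe]; abel
      rw [pow_succ, ← mul_assoc, ih, add_mul, smul_mul_assoc, mul_assoc, h1, mul_add,
        mul_smul_comm, ← mul_assoc, add_assoc, ← add_smul]
      congr 2
      push_cast
      ring
  have hfe (i : ℕ) : f * e ^ (i + 1) =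
      e ^ (i + 1) * f - (i + 1 : K) • (h * e ^ i - (i : K) • e ^ i) := by
    have h0 : f * e = e * f - h := by rw [← hef]; abel
    induction i with
    | zero => simp [h0]
    | succ i ih =>
      have h1 : e ^ (i + 1) * h = h * e ^ (i + 1) - (2 * ((i + 1 : ℕ) : K)) • e ^ (i + 1) := by
        rw [hhe', add_sub_cancel_right]
      rw [pow_succ, ← mul_assoc, ih, sub_mul, smul_mul_assoc, sub_mul, smul_mul_assoc, mul_assoc h,
        ← pow_succ, mul_assoc _ f, h0, mul_sub, ← mul_assoc, ← pow_succ, h1]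
      push_cast
      module
  have hrange (i : ℕ) : ∃ w, (e ^ i) w = u := by
    induction i with
    | zero => exact ⟨u, by simp⟩
    | succ i ih =>
      obtain ⟨w, hw⟩ := ih
      have h1 := LinearMap.congr_fun (hfe i) w
      have h2 : (e ^ (i + 1)) w = 0 := by rw [pow_succ', End.mul_apply, hw, hu]
      simp only [End.mul_apply, h2, map_zero, LinearMap.sub_apply, LinearMap.smul_apply,
        hw, hhu] at h1
      rw [← sub_smul, smul_smul, eq_comm, sub_eq_zero] at h1
      have hc : (i + 1 : K) * (-2 - i) ≠ 0 := by
        refine mul_ne_zero (Nat.cast_add_one_ne_zero i) ?_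
        have : (-2 - i : K) = -((i + 2 : ℕ) : K) := by push_cast; ring
        rw [this]
        exact neg_ne_zero.mpr (Nat.cast_ne_zero.mpr (by omega))
      refine ⟨((i + 1 : K) * (-2 - i))⁻¹ • f w, ?_⟩
      rw [map_smul, h1, inv_smul_smul₀ hc]
  obtain ⟨k, hk⟩ := he
  obtain ⟨w, hw⟩ := hrange k
  rw [← hw, hk, LinearMap.zero_apply]

end Module.End

namespace LieAlgebra.IsKilling

open Module

section

variable {K L : Type*} [Field K] [LieRing L] [LieAlgebra K L]

/-- The centralizer of a set, as a Lie subalgebra. -/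
def centralizer (K : Type*) {L : Type*} [Field K] [LieRing L] [LieAlgebra K L] (S : Set L) :
    LieSubalgebra K L where
  carrier := {x | ∀ s ∈ S, ⁅s, x⁆ = 0}
  add_mem' hx hy s hs := by rw [lie_add, hx s hs, hy s hs, add_zero]
  zero_mem' s _ := lie_zero s
  smul_mem' c x hx s hs := by rw [lie_smul, hx s hs, smul_zero]
  lie_mem' {x y} hx hy s hs := by rw [leibniz_lie, hx s hs, hy s hs, zero_lie, lie_zero, add_zero]

/-- Lift eigenvectors of squares: a semisimple endomorphism has `ker f ^ 2 = ker f`. -/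
theorem _root_.Module.End.IsSemisimple.apply_eq_zero_of_apply_apply {V : Type*} [AddCommGroup V]
    [Module K V] {f : End K V} (hf : f.IsSemisimple) {v : V} (h : f (f v) = 0) : f v = 0 := by
  have h1 : v ∈ f.genEigenspace 0 (2 : ℕ) := by
    rw [End.mem_genEigenspace_nat]
    simpa [pow_two] using h
  rw [hf.isFinitelySemisimple.genEigenspace_eq_eigenspace 0 (by norm_num)] at h1
  simpa [End.mem_eigenspace_iff] using h1

theorem _root_.LieAlgebra.eq_zero_of_forall_lie_eq_zero [LieModule.IsFaithful K L L] {x : L}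
    (h : ∀ y : L, ⁅x, y⁆ = 0) : x = 0 := by
  refine LieModule.IsFaithful.injective_toEnd (R := K) (L := L) (M := L) ?_
  ext y
  simp [h]

theorem lie_eq_smul_of_semisimple_part {x s : L}
    (hs : ∀ (μ : K), ∀ y ∈ (ad K L x).maxGenEigenspace μ, ⁅s, y⁆ = μ • y) {μ : K} {y : L}
    (hy : ⁅x, y⁆ = μ • y) : ⁅s, y⁆ = μ • y := by
  refine hs μ y ?_
  rw [End.mem_maxGenEigenspace]
  exact ⟨1, by simp [hy]⟩

end

variable {K L : Type*} [Field K] [IsAlgClosed K] [LieRing L] [LieAlgebra K L]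
  [FiniteDimensional K L]

theorem exists_isCartanSubalgebra_of_subset {S : Set L}
    (hS : ∀ s ∈ S, (ad K L s).IsSemisimple) (hc : ∀ s ∈ S, ∀ t ∈ S, ⁅s, t⁆ = 0) :
    ∃ H : LieSubalgebra K L, H.IsCartanSubalgebra ∧ S ⊆ H := by
  have : Infinite K := IsAlgClosed.instInfinite
  let m := centralizer K S
  obtain ⟨x, hx⟩ := LieAlgebra.exists_isCartanSubalgebra_engel K m
  set H' := LieSubalgebra.engel K x
  have hSH (s : L) (hs : s ∈ S) : ∃ h : s ∈ m, (⟨s, h⟩ : m) ∈ H' := by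
    refine ⟨fun t ht ↦ hc t ht s hs, ?_⟩
    rw [← hx.self_normalizing, LieSubalgebra.mem_normalizer_iff]
    intro y _
    convert H'.zero_mem
    exact Subtype.ext (y.2 s hs)
  refine ⟨H'.map m.incl, ⟨?_, ?_⟩, fun s hs ↦ ?_⟩
  · exact (LieEquiv.nilpotent_iff_equiv_nilpotent
      (H'.equivMapOfInjective (f := m.incl) Subtype.val_injective)).mp hx.nilpotent
  · refine le_antisymm (fun y hy ↦ ?_) (LieSubalgebra.le_normalizer _)
    rw [LieSubalgebra.mem_normalizer_iff] at hy
    have hym : y ∈ m := fun s hs ↦ by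
      obtain ⟨h1, h2⟩ := hSH s hs
      obtain ⟨z, -, hz⟩ := hy s ⟨_, h2, rfl⟩
      refine (hS s hs).apply_eq_zero_of_apply_apply (v := y) ?_
      change ⁅s, ⁅s, y⁆⁆ = 0
      rw [← lie_skew s y, lie_neg, ← hz, neg_eq_zero]
      exact z.2 s hs
    refine ⟨⟨y, hym⟩, ?_, rfl⟩
    have : (⟨y, hym⟩ : m) ∈ H'.normalizer := by
      rw [LieSubalgebra.mem_normalizer_iff]
      intro z hz
      obtain ⟨w, hw, hwy⟩ := hy z ⟨z, hz, rfl⟩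
      rwa [show ⁅(⟨y, hym⟩ : m), z⁆ = w from Subtype.ext hwy.symm]
    rwa [hx.self_normalizing] at this
  · obtain ⟨h1, h2⟩ := hSH s hs
    exact ⟨_, h2, rfl⟩

variable [IsKilling K L]

/-- The Jordan decomposition. -/
theorem exists_semisimple_part [CharZero K] (x : L) : ∃ s : L, (ad K L s).IsSemisimple ∧
    IsNilpotent (ad K L (x - s)) ∧ ⁅s, x⁆ = 0 ∧
    ∀ (μ : K), ∀ y ∈ (ad K L x).maxGenEigenspace μ, ⁅s, y⁆ = μ • y := by
  obtain ⟨N, -, S, hS₀, hN, hS, hSN⟩ := (ad K L x).exists_isNilpotent_isSemisimple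
  replace hS₀ : Commute (ad K L x) S := Algebra.commute_of_mem_adjoin_self hS₀
  rw [eq_sub_of_add_eq hSN.symm] at hN
  have aux {μ : K} {y : L} (hy : y ∈ (ad K L x).maxGenEigenspace μ) : S y = μ • y := by
    rw [End.maxGenEigenspace_eq] at hy
    exact End.apply_eq_of_mem_of_comm_of_isFinitelySemisimple_of_isNil hy hS₀
      hS.isFinitelySemisimple hN
  have h_der (y z : L) : S ⁅y, z⁆ = ⁅S y, z⁆ + ⁅y, S z⁆ := by
    have hy : y ∈ ⨆ μ, (ad K L x).maxGenEigenspace μ := by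
      simp [End.iSup_maxGenEigenspace_eq_top]
    have hz : z ∈ ⨆ μ, (ad K L x).maxGenEigenspace μ := by
      simp [End.iSup_maxGenEigenspace_eq_top]
    induction hy using Submodule.iSup_induction' with
    | mem α y hy =>
      induction hz using Submodule.iSup_induction' with
      | mem β z hz =>
        have hyz : ⁅y, z⁆ ∈ (ad K L x).maxGenEigenspace (α + β) :=
          LieModule.lie_mem_maxGenEigenspace_toEnd hy hz
        rw [aux hy, aux hz, aux hyz, smul_lie, lie_smul, ← add_smul]
      | zero => simp
      | add _ _ _ _ h h' => simp only [lie_add, map_add, h, h']; abel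
    | zero => simp
    | add _ _ _ _ h h' => simp only [add_lie, map_add, h, h']; abel
  replace h_der (y z : L) : S ⁅y, z⁆ = ⁅y, S z⁆ - ⁅z, S y⁆ := by
    rw [h_der, ← lie_skew (S y), add_comm, sub_eq_add_neg]
  obtain ⟨s, hs⟩ := LieDerivation.IsKilling.exists_eq_ad (⟨S, h_der⟩ : LieDerivation K L L)
  have hsS : ad K L s = S := by rw [← LieDerivation.coe_ad_apply_eq_ad_apply, hs]
  have hs' (μ : K) (y : L) (hy : y ∈ (ad K L x).maxGenEigenspace μ) : ⁅s, y⁆ = μ • y := by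
    rw [← ad_apply (R := K), hsS, aux hy]
  refine ⟨s, hsS ▸ hS, ?_, ?_, hs'⟩
  · rwa [map_sub, hsS]
  · rw [hs' 0 x, zero_smul]
    rw [End.mem_maxGenEigenspace]
    exact ⟨1, by simp⟩

theorem map_semisimple_part_eq_neg {x s : L}
    (hs : ∀ (μ : K), ∀ y ∈ (ad K L x).maxGenEigenspace μ, ⁅s, y⁆ = μ • y) (w : L ≃ₗ⁅K⁆ L)
    (hw : w x = -x) : w s = -s := by
  rw [← add_eq_zero_iff_eq_neg]
  refine eq_zero_of_forall_lie_eq_zero (K := K) fun y ↦ ?_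
  obtain ⟨y, rfl⟩ := w.surjective y
  have hy : y ∈ ⨆ μ, (ad K L x).maxGenEigenspace μ := by
    simp [End.iSup_maxGenEigenspace_eq_top]
  induction hy using Submodule.iSup_induction' with
  | mem μ y hy =>
    have hwy : w y ∈ (ad K L x).maxGenEigenspace (-μ) := by
      rw [End.mem_maxGenEigenspace] at hy ⊢
      obtain ⟨k, hk⟩ := hy
      refine ⟨k, ?_⟩
      have h (k : ℕ) (z : L) : ((ad K L x - (-μ) • (1 : End K L)) ^ k) (w z) =
          (-1 : K) ^ k • w (((ad K L x - μ • (1 : End K L)) ^ k) z) := by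
        induction k generalizing z with
        | zero => simp
        | succ k ih =>
          have h1 : (ad K L x - (-μ) • (1 : End K L)) (w z) =
              w (-((ad K L x - μ • (1 : End K L)) z)) := by
            have h2 : ⁅x, w z⁆ = -w ⁅x, z⁆ := by
              rw [LieEquiv.map_lie, hw, neg_lie, neg_neg]
            simp only [neg_smul, sub_neg_eq_add, LinearMap.add_apply, ad_apply, h2,
              LinearMap.smul_apply, End.one_apply, LinearMap.sub_apply, neg_sub, map_sub,
              map_smul]
            abel
          rw [pow_succ, End.mul_apply, h1, ih, map_neg, map_neg, pow_succ (-1 : K), mul_smul,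
            neg_one_smul, pow_succ, End.mul_apply]
      rw [h, hk, map_zero, smul_zero]
    change ⁅w s + s, w y⁆ = 0
    rw [add_lie, ← LieEquiv.map_lie, hs μ y hy, hs _ _ hwy, map_smul, neg_smul, add_neg_cancel]
  | zero => simp
  | add _ _ _ _ h h' => rw [map_add, lie_add, h, h', add_zero]

variable {H : LieSubalgebra K L} [H.IsCartanSubalgebra]

theorem eq_zero_of_forall_killingForm_eq_zero [CharZero K] {s t : L} (hs : s ∈ H) (ht : t ∈ H)
    {a b : K} {v : L} (hsv : ⁅s, v⁆ = a • v) (htv : ⁅t, v⁆ = b • v)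
    (h : ∀ y, ⁅s, y⁆ = -a • y → ⁅t, y⁆ = -b • y → killingForm K L v y = 0) : v = 0 := by
  refine (LieAlgebra.IsKilling.killingForm_nondegenerate K L).1 v fun y ↦ ?_
  have hy : y ∈ ⨆ χ : LieModule.Weight K H L, LieModule.genWeightSpace L χ := by
    rw [LieModule.iSup_genWeightSpace_eq_top']
    exact LieSubmodule.mem_top _
  induction hy using LieSubmodule.iSup_induction' with
  | mem α y hy =>
    have hα (z : H) : ⁅(z : L), y⁆ = α z • y := by
      rw [← lie_eq_smul_of_mem_rootSpace hy z, LieSubalgebra.coe_bracket_of_module]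
    have key (z : H) (c : K) (hz : ⁅(z : L), v⁆ = c • v) (hc : c + α z ≠ 0) :
        killingForm K L v y = 0 := by
      have h1 := LieModule.traceForm_apply_lie_apply K L L v z y
      rw [← lie_skew, hz, hα z, map_neg, map_smul, map_smul, LinearMap.neg_apply,
        LinearMap.smul_apply, smul_eq_mul, smul_eq_mul, neg_eq_iff_add_eq_zero, ← add_mul] at h1
      exact (mul_eq_zero.mp h1).resolve_left hc
    by_cases h1 : a + α ⟨s, hs⟩ = 0
    · by_cases h2 : b + α ⟨t, ht⟩ = 0
      · refine h y ?_ ?_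
        · rw [← eq_neg_of_add_eq_zero_right h1]
          exact hα ⟨s, hs⟩
        · rw [← eq_neg_of_add_eq_zero_right h2]
          exact hα ⟨t, ht⟩
      · exact key _ b htv h2
    · exact key _ a hsv h1
  | zero => simp
  | add _ _ _ _ h h' => rw [map_add, h, h', add_zero]

end LieAlgebra.IsKilling

namespace LieAlgebra.IsKilling

open Module

theorem _root_.LieAlgebra.ad_lie_eq_mul_sub_mul {K L : Type*} [CommRing K] [LieRing L]
    [LieAlgebra K L] (x y : L) :
    ad K L ⁅x, y⁆ = ad K L x * ad K L y - ad K L y * ad K L x := by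
  ext z
  simp

variable {K L : Type*} [Field K] [CharZero K] [IsAlgClosed K] [LieRing L] [LieAlgebra K L]
  [FiniteDimensional K L] [IsKilling K L]

theorem exists_lie_lie_eq_self {s n : L} (hs : (ad K L s).IsSemisimple) (hsn : ⁅s, n⁆ = 0)
    (hn : IsNilpotent (ad K L n)) : ∃ y, ⁅s, y⁆ = 0 ∧ ⁅n, ⁅n, y⁆⁆ = n := by
  let m : Submodule K L := LinearMap.ker (ad K L s)
  have hm (y : L) : y ∈ m ↔ ⁅s, y⁆ = 0 := by simp [m]
  have hnm (y : L) (hy : y ∈ m) : ⁅n, y⁆ ∈ m := by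
    rw [hm, leibniz_lie, hsn, zero_lie, (hm y).mp hy, lie_zero, add_zero]
  obtain ⟨H, hH, hsH⟩ := exists_isCartanSubalgebra_of_subset (K := K) (S := {s})
    (by simpa using hs) (by simp)
  have hnd (v : L) (hv : v ∈ m) (h : ∀ y ∈ m, killingForm K L v y = 0) : v = 0 := by
    have hv' : ⁅s, v⁆ = (0 : K) • v := by simpa [hm] using hv
    refine eq_zero_of_forall_killingForm_eq_zero (hsH rfl) (hsH rfl) hv' hv' fun y hy _ ↦ h y ?_
    simpa [hm] using hy
  by_contra! hcon
  have hnW : n ∉ m.map (ad K L n * ad K L n) := by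
    rintro ⟨y, hy, hyn⟩
    exact hcon y ((hm y).mp hy) hyn
  obtain ⟨ℓ, hℓn, hℓW⟩ := Submodule.exists_le_ker_of_notMem hnW
  let B : m →ₗ[K] Dual K m := (m.subtype.dualMap) ∘ₗ killingForm K L ∘ₗ m.subtype
  have hB : Function.Injective B := by
    rw [← LinearMap.ker_eq_bot, LinearMap.ker_eq_bot']
    intro v hv
    exact Subtype.ext (hnd v v.2 fun y hy ↦ LinearMap.congr_fun hv ⟨y, hy⟩)
  obtain ⟨⟨z, hz⟩, hzℓ⟩ :=
    ((LinearMap.injective_iff_surjective_of_finrank_eq_finrank (f := B) (by simp)).mp hB)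
      (m.subtype.dualMap ℓ)
  have hzℓ' (y : L) (hy : y ∈ m) : killingForm K L z y = ℓ y := LinearMap.congr_fun hzℓ ⟨y, hy⟩
  have hsymm (a b c : L) : killingForm K L ⁅a, b⁆ c = - killingForm K L b ⁅a, c⁆ := by
    rw [← lie_skew, map_neg, LinearMap.neg_apply, killingForm,
      LieModule.traceForm_apply_lie_apply]
  have hnnz : ⁅n, ⁅n, z⁆⁆ = 0 := by
    refine hnd _ (hnm _ (hnm _ hz)) fun y hy ↦ ?_
    rw [hsymm, hsymm, hzℓ' _ (hnm _ (hnm _ hy)), neg_neg]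
    exact hℓW ⟨y, hy, rfl⟩
  have hcomm : Commute (ad K L n) (ad K L n * ad K L z - ad K L z * ad K L n) := by
    rw [← ad_lie_eq_mul_sub_mul, Commute, SemiconjBy, ← sub_eq_zero, ← ad_lie_eq_mul_sub_mul, hnnz,
      map_zero]
  refine hℓn ?_
  rw [← hzℓ' n ((hm n).mpr hsn), killingForm, LieModule.traceForm_comm]
  exact End.trace_mul_eq_zero_of_commute_commutator hn hcomm

/-- The Jacobson–Morozov theorem in the centralizer of a semisimple element. -/
theorem exists_sl2_triple {s e : L} (hs : (ad K L s).IsSemisimple) (hse : ⁅s, e⁆ = 0)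
    (he : IsNilpotent (ad K L e)) : ∃ h f : L, ⁅s, h⁆ = 0 ∧ ⁅s, f⁆ = 0 ∧ ⁅e, f⁆ = h ∧
      ⁅h, e⁆ = (2 : K) • e ∧ ⁅h, f⁆ = (-2 : K) • f := by
  obtain ⟨y, hsy, hy⟩ := exists_lie_lie_eq_self hs hse he
  obtain ⟨f₀, hf₀⟩ : ∃ f₀, f₀ = (-2 : K) • y := ⟨_, rfl⟩
  obtain ⟨h, hh⟩ : ∃ h, h = ⁅e, f₀⁆ := ⟨_, rfl⟩
  have hsf₀ : ⁅s, f₀⁆ = 0 := by rw [hf₀, lie_smul, hsy, smul_zero]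
  have hsh : ⁅s, h⁆ = 0 := by rw [hh, leibniz_lie, hse, hsf₀, zero_lie, lie_zero, add_zero]
  have hhe : ⁅h, e⁆ = (2 : K) • e := by
    rw [← lie_skew, hh, hf₀, lie_smul, lie_smul, hy]
    module
  have heh : ⁅e, h⁆ = (-2 : K) • e := by rw [← lie_skew, hhe, neg_smul]
  let Z : Submodule K L := LinearMap.ker (ad K L s) ⊓ LinearMap.ker (ad K L e)
  have hZ (z : L) : z ∈ Z ↔ ⁅s, z⁆ = 0 ∧ ⁅e, z⁆ = 0 := by simp [Z]
  have hmaps (z : L) (hz : z ∈ Z) : (ad K L h + (2 : K) • (1 : End K L)) z ∈ Z := by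
    obtain ⟨h1, h2⟩ := (hZ z).mp hz
    rw [hZ]
    simp [h1, h2, leibniz_lie s h, leibniz_lie e h, hsh, heh]
  let T : Z →ₗ[K] Z := (ad K L h + (2 : K) • (1 : End K L)).restrict hmaps
  have hT : Function.Injective T := by
    rw [← LinearMap.ker_eq_bot, LinearMap.ker_eq_bot']
    intro z hz
    refine Subtype.ext (End.eq_zero_of_commutator_eq_neg_two_smul (f := ad K L f₀) (h := ad K L h)
      he ?_ ?_ ((hZ z).mp z.2).2 ?_)
    · rw [← ad_lie_eq_mul_sub_mul, hh]
    · rw [← ad_lie_eq_mul_sub_mul, hhe, map_smul]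
    · have := congr_arg Subtype.val hz
      rw [neg_smul, eq_neg_iff_add_eq_zero]
      exact this
  have hg : ⁅h, f₀⁆ + (2 : K) • f₀ ∈ Z := by
    rw [hZ]
    constructor
    · simp [leibniz_lie s h, hsh, hsf₀]
    · simp [leibniz_lie e h, heh, ← hh]
  obtain ⟨⟨f₁, hf₁⟩, hT₁⟩ := (LinearMap.injective_iff_surjective.mp hT) ⟨_, hg⟩
  have hf₁' : ⁅h, f₁⁆ + (2 : K) • f₁ = ⁅h, f₀⁆ + (2 : K) • f₀ := congr_arg Subtype.val hT₁
  obtain ⟨h1, h2⟩ := (hZ f₁).mp hf₁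
  refine ⟨h, f₀ - f₁, hsh, by simp [hsf₀, h1], by simp [h2, hh], hhe, ?_⟩
  rw [lie_sub, ← sub_eq_zero]
  calc _ = (⁅h, f₀⁆ + (2 : K) • f₀) - (⁅h, f₁⁆ + (2 : K) • f₁) := by module
    _ = 0 := by rw [hf₁', sub_self]

end LieAlgebra.IsKilling

namespace LieAlgebra

open Module

theorem bijective_of_apply_ne_zero {K L : Type*} [Field K] [LieRing L] [LieAlgebra K L]
    [FiniteDimensional K L] [IsSimple K L] (F : L →ₗ⁅K⁆ L) {t : L} (ht : F t ≠ 0) :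
    Function.Bijective F := by
  have hinj : Function.Injective F := by
    rw [← LieHom.ker_eq_bot]
    refine (IsSimple.eq_bot_or_eq_top F.ker).resolve_right fun h ↦ ht ?_
    rw [← LieHom.mem_ker, h]
    exact LieSubmodule.mem_top t
  exact ⟨hinj, LinearMap.injective_iff_surjective (f := (F : L →ₗ[K] L)).mp hinj⟩

section Exp

variable {K L : Type*} [Field K] [CharZero K] [LieRing L] [LieAlgebra K L]

theorem exists_equiv_apply_eq_sum {a : L} (ha : IsNilpotent (ad K L a)) :
    ∃ E : L ≃ₗ⁅K⁆ L, ∀ (k : ℕ) (x : L), ((ad K L a) ^ k) x = 0 →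
      E x = ∑ i ∈ Finset.range k, (i.factorial : K)⁻¹ • ((ad K L a) ^ i) x := by
  let : Module ℚ L := Module.compHom L (algebraMap ℚ K)
  let : LieAlgebra ℚ L :=
    { lie_smul := fun q x y ↦ by
        rw [← Rat.cast_smul_eq_qsmul K, ← Rat.cast_smul_eq_qsmul K, lie_smul] }
  have hD : (LieDerivation.ad K L a).toLinearMap = ad K L a :=
    LieDerivation.coe_ad_apply_eq_ad_apply a
  refine ⟨LieDerivation.exp (LieDerivation.ad K L a) (hD ▸ ha), fun k x hk ↦ ?_⟩
  rw [LieDerivation.exp_map_apply, hD]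
  refine (IsNilpotent.exp_smul_eq_sum (M := L) (a := ad K L a) (m := x) hk ha).trans ?_
  refine Finset.sum_congr rfl fun i _ ↦ ?_
  rw [← Rat.cast_smul_eq_qsmul K]
  simp

theorem exists_equiv_apply_eq {a : L} (ha : IsNilpotent (ad K L a)) :
    ∃ E : L ≃ₗ⁅K⁆ L, ∀ x, ⁅a, ⁅a, ⁅a, x⁆⁆⁆ = 0 → E x = x + ⁅a, x⁆ + (2 : K)⁻¹ • ⁅a, ⁅a, x⁆⁆ := by
  obtain ⟨E, hE⟩ := exists_equiv_apply_eq_sum ha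
  refine ⟨E, fun x hx ↦ ?_⟩
  rw [hE 3 x (by simpa [pow_succ] using hx)]
  simp [Finset.sum_range_succ, pow_succ]

/-- The Weyl reflection of an `sl₂`-triple. -/
theorem exists_equiv_apply_eq_neg_of_sl2 {s h e f : L} (he : IsNilpotent (ad K L e))
    (hf : IsNilpotent (ad K L f)) (hse : ⁅s, e⁆ = 0) (hsf : ⁅s, f⁆ = 0) (hef : ⁅e, f⁆ = h)
    (hhe : ⁅h, e⁆ = (2 : K) • e) (hhf : ⁅h, f⁆ = (-2 : K) • f) :
    ∃ w : L ≃ₗ⁅K⁆ L, w s = s ∧ w h = -h := by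
  obtain ⟨E, hE⟩ := exists_equiv_apply_eq he
  obtain ⟨F, hF⟩ := exists_equiv_apply_eq (K := K) (a := -f) (by rwa [map_neg, isNilpotent_neg_iff])
  have hes : ⁅e, s⁆ = 0 := by rw [← lie_skew, hse, neg_zero]
  have hfs : ⁅f, s⁆ = 0 := by rw [← lie_skew, hsf, neg_zero]
  have heh : ⁅e, h⁆ = (-2 : K) • e := by rw [← lie_skew, hhe, neg_smul]
  have hfh : ⁅f, h⁆ = (2 : K) • f := by rw [← lie_skew, hhf, neg_smul, neg_neg]
  have hfe : ⁅f, e⁆ = -h := by rw [← lie_skew, hef]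
  have hEs : E s = s := by rw [hE s (by simp [hes])]; simp [hes]
  have hFs : F s = s := by rw [hF s (by simp [hfs])]; simp [hfs]
  have hEh : E h = h - (2 : K) • e := by
    rw [hE h (by simp [heh])]
    simp [heh, sub_eq_add_neg]
  have hEe : E e = e := by rw [hE e (by simp)]; simp
  have hFh : F h = h - (2 : K) • f := by
    rw [hF h (by simp [hfh])]
    simp [hfh, sub_eq_add_neg]
  have hFe : F e = e + h - f := by
    rw [hF e (by simp [hfe, hfh])]
    simp [hfe, hfh, sub_eq_add_neg]
  refine ⟨(E.trans F).trans E, by simp [LieEquiv.trans_apply, hEs, hFs], ?_⟩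
  have h1 : F (E h) = -h - (2 : K) • e := by
    rw [hEh, map_sub, map_smul, hFh, hFe]
    module
  rw [LieEquiv.trans_apply, LieEquiv.trans_apply, h1, map_sub, map_neg, map_smul, hEh, hEe]
  module

theorem eq_zero_of_lie_eq_zero_of_lie_eq_neg_two {t h e f z : L} (he : IsNilpotent (ad K L e))
    (hef : ⁅e, f⁆ = h) (hhe : ⁅h, e⁆ = (2 : K) • e) (hth : ⁅t, h⁆ = 0)
    (hte : ⁅t, e⁆ = (2 : K) • e) (hn : IsNilpotent (ad K L (h - t)))
    (htz : ⁅t, z⁆ = (-2 : K) • z) (hez : ⁅e, z⁆ = 0) : z = 0 := by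
  have key (u : L) (hu : ⁅e, u⁆ = 0) (hhu : ⁅h, u⁆ = (-2 : K) • u) : u = 0 := by
    refine End.eq_zero_of_commutator_eq_neg_two_smul (f := ad K L f) (h := ad K L h) he ?_ ?_ hu hhu
    · rw [← ad_lie_eq_mul_sub_mul, hef]
    · rw [← ad_lie_eq_mul_sub_mul, hhe, map_smul]
  obtain ⟨k, hk⟩ := hn
  replace hk : ((ad K L (h - t)) ^ k) z = 0 := by rw [hk, LinearMap.zero_apply]
  induction k generalizing z with
  | zero => simpa using hk
  | succ k ih =>
    have h1 : ⁅h - t, z⁆ = 0 := by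
      refine ih ?_ ?_ ?_
      · rw [leibniz_lie, htz, lie_sub, hth, lie_self, sub_zero, zero_lie, zero_add, lie_smul]
      · have : ⁅e, h - t⁆ = 0 := by rw [← lie_skew, sub_lie, hhe, hte, sub_self, neg_zero]
        rw [leibniz_lie, this, hez, lie_zero, zero_lie, add_zero]
      · rwa [pow_succ] at hk
    refine key z hez ?_
    rw [← htz, ← sub_eq_zero, ← sub_lie, h1]

end Exp

variable {K L : Type*} [Field K] [CharZero K] [IsAlgClosed K] [LieRing L] [LieAlgebra K L]
  [FiniteDimensional K L]

namespace IsKilling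

variable [IsKilling K L]

theorem exists_lie_eq_of_lie_eq_two {H : LieSubalgebra K L} [H.IsCartanSubalgebra]
    {s t h e f x : L} (hs : s ∈ H) (ht : t ∈ H) (he : IsNilpotent (ad K L e)) (hse : ⁅s, e⁆ = 0)
    (hef : ⁅e, f⁆ = h) (hhe : ⁅h, e⁆ = (2 : K) • e)
    (hth : ⁅t, h⁆ = 0) (hte : ⁅t, e⁆ = (2 : K) • e) (hn : IsNilpotent (ad K L (h - t)))
    (hsx : ⁅s, x⁆ = 0) (htx : ⁅t, x⁆ = (2 : K) • x) :
    ∃ y : L, ⁅s, y⁆ = 0 ∧ ⁅t, y⁆ = 0 ∧ ⁅y, e⁆ = x := by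
  let E (c : K) : Submodule K L :=
    LinearMap.ker (ad K L s) ⊓ LinearMap.ker (ad K L t - c • (1 : End K L))
  have hE (c : K) (y : L) : y ∈ E c ↔ ⁅s, y⁆ = 0 ∧ ⁅t, y⁆ = c • y := by simp [E, sub_eq_zero]
  let U : Submodule K L := (E 0).map (ad K L e)
  have hUV : U ≤ E 2 := by
    rintro _ ⟨y, hy, rfl⟩
    obtain ⟨h1, h2⟩ := (hE 0 y).mp hy
    rw [hE, ad_apply]
    simp [leibniz_lie s e, leibniz_lie t e, h1, h2, hse, hte]
  have hB (P Q : Submodule K L) (hPQ : ∀ v ∈ P, (∀ y ∈ Q, killingForm K L v y = 0) → v = 0) :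
      finrank K P ≤ finrank K Q := by
    let B : P →ₗ[K] Dual K Q := Q.subtype.dualMap ∘ₗ killingForm K L ∘ₗ P.subtype
    have hB : Function.Injective B := by
      rw [← LinearMap.ker_eq_bot, LinearMap.ker_eq_bot']
      intro v hv
      exact Subtype.ext (hPQ v v.2 fun y hy ↦ LinearMap.congr_fun hv ⟨y, hy⟩)
    simpa using LinearMap.finrank_le_finrank_of_injective hB
  have hnd (c : K) (v : L) (hv : v ∈ E c) (h : ∀ y ∈ E (-c), killingForm K L v y = 0) : v = 0 := by
    obtain ⟨h1, h2⟩ := (hE c v).mp hv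
    refine eq_zero_of_forall_killingForm_eq_zero hs ht (a := 0) (by simpa using h1) h2
      fun y h3 h4 ↦ h y ((hE _ y).mpr ⟨by simpa using h3, h4⟩)
  have h1 : finrank K (E 2) ≤ finrank K (E (-2)) := hB _ _ (hnd 2)
  have h2 : finrank K (E (-2)) ≤ finrank K U := by
    refine hB _ _ fun z hz h ↦ ?_
    obtain ⟨h3, h4⟩ := (hE _ z).mp hz
    refine eq_zero_of_lie_eq_zero_of_lie_eq_neg_two he hef hhe hth hte hn h4 ?_
    refine hnd 0 _ ((hE _ _).mpr ?_) fun y hy ↦ ?_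
    · simp [leibniz_lie s e, leibniz_lie t e, h3, h4, hse, hte]
    · rw [neg_zero] at hy
      rw [← lie_skew, map_neg, LinearMap.neg_apply, neg_eq_zero, killingForm,
        LieModule.traceForm_apply_lie_apply]
      exact h _ ⟨y, hy, rfl⟩
  have hx : x ∈ U := by
    rw [Submodule.eq_of_le_of_finrank_le hUV (h1.trans h2), hE]
    exact ⟨hsx, htx⟩
  obtain ⟨y, hy, hyx⟩ := hx
  obtain ⟨h5, h6⟩ := (hE 0 y).mp hy
  refine ⟨-y, by simp [h5], by simp [h6], ?_⟩
  rw [neg_lie, lie_skew]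
  exact hyx

end IsKilling

variable [IsSimple K L]

/-- Every element of a simple Lie algebra is mapped to its negative by some automorphism. -/
theorem exists_equiv_apply_eq_neg (x : L) : ∃ θ : L ≃ₗ⁅K⁆ L, θ x = -x := by
  obtain ⟨s, hs, hn, hsx, -⟩ := IsKilling.exists_semisimple_part (K := K) x
  obtain ⟨e, hex⟩ : ∃ e, e = x - s := ⟨_, rfl⟩
  rw [← hex] at hn
  have hse : ⁅s, e⁆ = 0 := by rw [hex, lie_sub, hsx, lie_self, sub_zero]
  suffices ∃ θ : L ≃ₗ⁅K⁆ L, θ s = -s ∧ θ e = -e by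
    obtain ⟨θ, h1, h2⟩ := this
    refine ⟨θ, ?_⟩
    rw [← add_sub_cancel s x, ← hex, map_add, h1, h2, neg_add]
  obtain ⟨h, f, hsh, hsf, hef, hhe, hhf⟩ := IsKilling.exists_sl2_triple hs hse hn
  obtain ⟨t, ht, htn, hth, hht⟩ := IsKilling.exists_semisimple_part (K := K) h
  have hte : ⁅t, e⁆ = (2 : K) • e := IsKilling.lie_eq_smul_of_semisimple_part hht hhe
  have hst : ⁅s, t⁆ = 0 := by
    have : ⁅t, s⁆ = (0 : K) • s := IsKilling.lie_eq_smul_of_semisimple_part hht (by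
      rw [← lie_skew, hsh, neg_zero, zero_smul])
    rw [← lie_skew, this, zero_smul, neg_zero]
  obtain ⟨H, hH, hSH⟩ := IsKilling.exists_isCartanSubalgebra_of_subset (K := K) (S := {s, t})
    (by simp [hs, ht]) (by simp [hst, ← lie_skew t s])
  have hsH : s ∈ H := hSH (by simp)
  have htH : t ∈ H := hSH (by simp)
  obtain ⟨ω, hω⟩ := exists_equiv_eq_neg_on_cartan H
  by_cases he0 : e = 0
  · exact ⟨ω, hω s hsH, by simp [he0]⟩
  have hfn : IsNilpotent (ad K L f) := by
    refine End.isNilpotent_of_commutator_eq_smul (g := ad K L h) (c := (-2 : K)) (by simp) ?_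
    rw [← ad_lie_eq_mul_sub_mul, hhf, map_smul]
  obtain ⟨w, hws, hwh⟩ := exists_equiv_apply_eq_neg_of_sl2 hn hfn hse hsf hef hhe hhf
  have hwt : w t = -t := IsKilling.map_semisimple_part_eq_neg hht w hwh
  obtain ⟨ρ, hρ⟩ : ∃ ρ, ρ = ω.trans w := ⟨_, rfl⟩
  have hρs : ρ s = -s := by rw [hρ, LieEquiv.trans_apply, hω s hsH, map_neg, hws]
  have hρt : ρ t = t := by rw [hρ, LieEquiv.trans_apply, hω t htH, map_neg, hwt, neg_neg]
  have hρs' : ρ.symm s = -s := by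
    rw [← neg_eq_iff_eq_neg, ← map_neg, ← hρs,
      LieEquiv.symm_apply_apply]
  have hρt' : ρ.symm t = t := by
    conv_lhs => rw [← hρt]
    rw [LieEquiv.symm_apply_apply]
  let V : Submodule K L :=
    LinearMap.ker (ad K L s) ⊓ LinearMap.ker (ad K L t - (2 : K) • (1 : End K L))
  have hV (y : L) : y ∈ V ↔ ⁅s, y⁆ = 0 ∧ ⁅t, y⁆ = (2 : K) • y := by simp [V, sub_eq_zero]
  have hρV (x : L) (hx : x ∈ V) : ρ x ∈ V := by
    obtain ⟨h1, h2⟩ := (hV x).mp hx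
    rw [hV]
    constructor
    · rw [← neg_neg s, ← hρs, neg_lie, ← LieEquiv.map_lie, h1, map_zero, neg_zero]
    · conv_lhs => rw [← hρt]
      rw [← LieEquiv.map_lie, h2, map_smul]
  have hρV' (x : L) (hx : x ∈ V) : ρ.symm x ∈ V := by
    obtain ⟨h1, h2⟩ := (hV x).mp hx
    rw [hV]
    constructor
    · rw [← neg_neg s, ← hρs', neg_lie, ← LieEquiv.map_lie, h1, map_zero, neg_zero]
    · conv_lhs => rw [← hρt']
      rw [← LieEquiv.map_lie, h2, map_smul]
  have heV : e ∈ V := (hV e).mpr ⟨hse, hte⟩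
  let M : Set L := {y | ⁅s, y⁆ = 0 ∧ ⁅t, y⁆ = 0}
  have hMe (x : L) (hx : x ∈ V) : ∃ y ∈ (M : Set L), ⁅y, e⁆ = x := by
    obtain ⟨h1, h2⟩ := (hV x).mp hx
    obtain ⟨y, hsy, hty, hyx⟩ :=
      IsKilling.exists_lie_eq_of_lie_eq_two hsH htH hn hse hef hhe hth hte htn h1 h2
    exact ⟨y, ⟨hsy, hty⟩, hyx⟩
  have hMe' (x : L) (hx : x ∈ V) : ∃ y ∈ (M : Set L), ⁅y, -ρ e⁆ = x := by
    obtain ⟨y, ⟨hsy, hty⟩, hyx⟩ := hMe _ (hρV' x hx)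
    refine ⟨-ρ y, ⟨?_, ?_⟩, ?_⟩
    · rw [← neg_neg s, ← hρs, neg_lie, lie_neg, ← LieEquiv.map_lie, hsy, map_zero, neg_zero,
        neg_zero]
    · rw [← hρt, lie_neg, ← LieEquiv.map_lie, hty, map_zero, neg_zero]
    · rw [neg_lie, lie_neg, neg_neg, ← LieEquiv.map_lie, hyx, LieEquiv.apply_symm_apply]
  obtain ⟨F, G, hF, hG, hFG⟩ := GenericEndomorphism.exists_lieHom_apply_eq {s, t} V M
    (fun y hy z hz ↦ by
      rcases hz with rfl | rfl
      · rw [← lie_skew, hy.1, neg_zero]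
      · rw [← lie_skew, hy.2, neg_zero])
    (fun y hy x hx ↦ by
      obtain ⟨h1, h2⟩ := (hV x).mp hx
      rw [hV, leibniz_lie s, leibniz_lie t, hy.1, hy.2, h1, h2]
      simp)
    heV (V.neg_mem (hρV e heV)) hMe hMe'
  have ht0 : t ≠ 0 := fun h ↦ he0 (by simpa [h] using hte.symm)
  have hFb := bijective_of_apply_ne_zero F (t := t) (by rwa [hF t (by simp)])
  let F' := LieEquiv.ofBijective F hFb
  have hF's : F'.symm s = s := by
    conv_lhs => rw [← hF s (by simp)]
    exact F'.symm_apply_apply s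
  have hGb := bijective_of_apply_ne_zero G (t := t) (by rwa [hG t (by simp)])
  let G' := LieEquiv.ofBijective G hGb
  have hF'G (y : L) : (ρ.trans (G'.trans F'.symm)) y = F'.symm (G (ρ y)) := rfl
  refine ⟨ρ.trans (G'.trans F'.symm), ?_, ?_⟩
  · rw [hF'G, hρs, map_neg, hG s (by simp), map_neg, hF's]
  · rw [hF'G, ← neg_neg (G (ρ e)), ← map_neg, ← hFG, map_neg, neg_inj]
    exact F'.symm_apply_apply e

end LieAlgebra

namespace LieAlgebra

section RootSpace

variable {K L : Type*} [Field K] [CharZero K] [LieRing L] [LieAlgebra K L] [FiniteDimensional K L]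
  [IsKilling K L] {H : LieSubalgebra K L} [H.IsCartanSubalgebra] [IsTriangularizable K H L]

namespace IsKilling

theorem coe_lie_eq_smul_of_mem_rootSpace {α : H → K} {x : L} (hx : x ∈ rootSpace H α) (h : H) :
    ⁅(h : L), x⁆ = α h • x := by
  rw [← LieSubalgebra.coe_bracket_of_module, lie_eq_smul_of_mem_rootSpace hx]

omit [CharZero K] [IsTriangularizable K H L] in
theorem lie_eq_zero_of_mem_cartan {x y : L} (hx : x ∈ H) (hy : y ∈ H) : ⁅x, y⁆ = 0 :=
  congrArg Subtype.val (trivial_lie_zero H H ⟨x, hx⟩ ⟨y, hy⟩)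

omit [CharZero K] [IsKilling K L] in
variable (H) in
theorem rootSpace_induction {p : L → Prop} (zero : ∀ x ∈ H, p x)
    (root : ∀ χ : Weight K H L, χ.IsNonZero → ∀ x ∈ rootSpace H χ, p x)
    (add : ∀ x y, p x → p y → p (x + y)) (x : L) : p x := by
  have hx : x ∈ ⨆ χ : Weight K H L, genWeightSpace L χ := by
    rw [iSup_genWeightSpace_eq_top' K H L]; exact LieSubmodule.mem_top x
  induction hx using LieSubmodule.iSup_induction' with
  | mem χ x hx =>
    by_cases hχ : χ.IsZero
    · refine zero x ?_
      have : x ∈ rootSpace H (0 : H → K) := by rw [← hχ.eq]; exact hx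
      rwa [rootSpace_zero_eq] at this
    · exact root χ hχ x hx
  | zero => exact zero 0 H.zero_mem
  | add x y _ _ hx hy => exact add x y hx hy

theorem exists_apply_eq_zero_and_apply_ne_zero {α β : Weight K H L} (hα : α.IsNonZero)
    (hβ : β.IsNonZero) (h : α ≠ β) (h' : α ≠ -β) : ∃ t : H, β t = 0 ∧ α t ≠ 0 := by
  by_contra! hc
  have key : (α : H → K) = (α (coroot β) / 2) • β := by
    funext t
    have h1 : β (t - (β t / 2) • coroot β) = 0 := by
      rw [← Weight.toLinear_apply, map_sub, map_smul, Weight.toLinear_apply, Weight.toLinear_apply,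
        root_apply_coroot hβ, smul_eq_mul, div_mul_cancel₀ _ two_ne_zero, sub_self]
    have h2 := hc _ h1
    rw [← Weight.toLinear_apply, map_sub, map_smul, Weight.toLinear_apply, Weight.toLinear_apply,
      smul_eq_mul, sub_eq_zero] at h2
    rw [h2, Pi.smul_apply, smul_eq_mul]
    ring
  exact (eq_neg_or_eq_of_eq_smul β α hα _ key).elim h' h

omit [CharZero K] in
theorem exists_killingForm_ne_zero {α : Weight K H L} {x : L} (hx : x ∈ rootSpace H α)
    (hx0 : x ≠ 0) : ∃ y ∈ rootSpace H (-α), killingForm K L x y ≠ 0 := by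
  by_contra! hc
  have := mem_ker_killingForm_of_mem_rootSpace_of_forall_rootSpace_neg K L H hx hc
  simp at this
  exact hx0 this

end IsKilling

/-- The trilinear form `κ([x, y], z)`. -/
noncomputable def lieKillingForm (K L : Type*) [Field K] [LieRing L] [LieAlgebra K L] :
    L →ₗ[K] L →ₗ[K] L →ₗ[K] K :=
  LinearMap.compr₂ (ad K L : L →ₗ[K] L →ₗ[K] L) (killingForm K L)

@[simp]
theorem lieKillingForm_apply (K : Type*) {L : Type*} [Field K] [LieRing L] [LieAlgebra K L]
    (x y z : L) : lieKillingForm K L x y z = killingForm K L ⁅x, y⁆ z := rfl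

/-- An alternating trilinear form `F` is locally invariant along `H` if the alternating bracket
`[x, y]'` given by `κ([x, y]', z) = F x y z` vanishes, to first order along root vectors,
on all `[s, y] = 0` with `s ∈ H`. -/
structure IsLocallyInvariant (H : LieSubalgebra K L) [H.IsCartanSubalgebra]
    [IsTriangularizable K H L] (F : L →ₗ[K] L →ₗ[K] L →ₗ[K] K) : Prop where
  swap (x y z : L) : F y x z = -F x y z
  rotate (x y z : L) : F y z x = F x y z
  apply_eq_zero {s y : L} (z : L) : s ∈ H → ⁅s, y⁆ = 0 → F s y z = 0
  apply_lie {α : Weight K H L} {s y a : L} (z : L) : s ∈ H → ⁅s, y⁆ = 0 → α.IsNonZero →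
    a ∈ rootSpace H α → F ⁅a, s⁆ y z + F s ⁅a, y⁆ z = 0

namespace IsLocallyInvariant

variable {F : L →ₗ[K] L →ₗ[K] L →ₗ[K] K}

omit [CharZero K] [FiniteDimensional K L] [IsKilling K L] in
theorem lieKillingForm : IsLocallyInvariant H (lieKillingForm K L) where
  swap x y z := by
    rw [lieKillingForm_apply, lieKillingForm_apply, ← lie_skew, map_neg, LinearMap.neg_apply]
  rotate x y z := by
    simp only [lieKillingForm_apply, killingForm]
    rw [LieModule.traceForm_comm, ← LieModule.traceForm_apply_lie_apply]
  apply_eq_zero z _ h := by simp [h]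
  apply_lie {α s y a} z _ h _ _ := by
    have : ⁅⁅a, s⁆, y⁆ + ⁅s, ⁅a, y⁆⁆ = ⁅a, ⁅s, y⁆⁆ := by rw [leibniz_lie a s y]
    rw [lieKillingForm_apply, lieKillingForm_apply, ← LinearMap.add_apply, ← map_add, this, h]
    simp

omit [CharZero K] [FiniteDimensional K L] [IsKilling K L] in
theorem add_smul {G : L →ₗ[K] L →ₗ[K] L →ₗ[K] K} (hF : IsLocallyInvariant H F)
    (hG : IsLocallyInvariant H G) (c : K) : IsLocallyInvariant H (F + c • G) where
  swap x y z := by simp [hF.swap x y z, hG.swap x y z, add_comm]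
  rotate x y z := by simp [hF.rotate x y z, hG.rotate x y z]
  apply_eq_zero z h h' := by simp [hF.apply_eq_zero z h h', hG.apply_eq_zero z h h']
  apply_lie {α s y a} z h h' hα ha := by
    have h1 := hF.apply_lie z h h' hα ha
    have h2 := hG.apply_lie z h h' hα ha
    simp only [LinearMap.add_apply, LinearMap.smul_apply, smul_eq_mul]
    linear_combination h1 + c * h2

variable (hF : IsLocallyInvariant H F)
include hF

omit [CharZero K] [FiniteDimensional K L] [IsKilling K L] in
theorem swap_right (x y z : L) : F x z y = -F x y z := by
  rw [hF.rotate y x z, hF.swap]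

theorem smul_apply_comm {α : Weight K H L} (hα : α.IsNonZero) {e : L} (he : e ∈ rootSpace H α)
    (s t : H) (z : L) : α s * F t e z = α t * F s e z := by
  have h := hF.apply_lie z s.2 (lie_eq_zero_of_mem_cartan s.2 t.2) hα he
  rw [← lie_skew, ← lie_skew e, coe_lie_eq_smul_of_mem_rootSpace he,
    coe_lie_eq_smul_of_mem_rootSpace he] at h
  simp only [map_neg, map_smul, LinearMap.neg_apply, LinearMap.smul_apply, smul_eq_mul] at h
  rw [hF.swap t e] at h
  linear_combination h

theorem apply_eq_zero_of_ne_neg {α β : Weight K H L} (hα : α.IsNonZero) (hβ : β.IsNonZero)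
    (h : β ≠ -α) {e f : L} (he : e ∈ rootSpace H α) (hf : f ∈ rootSpace H β) (s : H) :
    F s e f = 0 := by
  by_cases hαβ : β = α
  · subst hαβ
    by_cases he0 : e = 0
    · simp [he0]
    obtain ⟨c, rfl⟩ := exists_smul_eq_of_mem_rootSpace hα he hf he0
    have h1 := hF.swap_right (s : L) e e
    rw [map_smul]
    have : F s e e = 0 := by linear_combination h1 / 2
    simp [this]
  obtain ⟨t, ht, ht'⟩ := exists_apply_eq_zero_and_apply_ne_zero hβ hα hαβ h
  obtain ⟨u, hu, hu'⟩ := exists_apply_eq_zero_and_apply_ne_zero hα hβ (Ne.symm hαβ)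
    fun h' ↦ h (by rw [h', neg_neg])
  have h1 := hF.smul_apply_comm hα he s t f
  have h2 := hF.smul_apply_comm hβ hf s t e
  have h3 := hF.smul_apply_comm hα he s u f
  rw [hF.swap_right s e f, hF.swap_right t e f] at h2
  rw [ht, zero_mul] at h1
  by_contra h0
  have h4 : α s ≠ 0 := fun h ↦ mul_ne_zero hu' h0 (by rw [← h3, h, zero_mul])
  have h5 : F t e f = 0 := (mul_eq_zero.mp h1).resolve_left h4
  rw [h5, neg_zero, mul_zero, zero_eq_mul] at h2
  exact h2.elim ht' (by simpa using h0)

theorem exists_mul_apply_eq {α β : Weight K H L} (hα : α.IsNonZero) (hβ : β.IsNonZero)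
    (h : α ≠ β) (h' : α ≠ -β) : ∃ t : H, α t ≠ 0 ∧ β t = 0 ∧ ∀ e ∈ rootSpace H α,
      ∀ f ∈ rootSpace H β, ∀ z, α t * F e f z = F t ⁅e, f⁆ z := by
  obtain ⟨t, ht, ht'⟩ := exists_apply_eq_zero_and_apply_ne_zero hα hβ h h'
  refine ⟨t, ht', ht, fun e he f hf z ↦ ?_⟩
  have h1 := hF.apply_lie z t.2 (y := f) (by
    rw [coe_lie_eq_smul_of_mem_rootSpace hf, ht, zero_smul]) hα he
  rw [← lie_skew, coe_lie_eq_smul_of_mem_rootSpace he] at h1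
  simp only [map_neg, map_smul, LinearMap.neg_apply, LinearMap.smul_apply, smul_eq_mul] at h1
  linear_combination -h1

theorem eq_zero_of_apply_cartan (h : ∀ s ∈ H, ∀ y z, F s y z = 0) (x y z : L) : F x y z = 0 := by
  have h2 (y : L) (hy : y ∈ H) (x z : L) : F x y z = 0 := by rw [hF.swap, h y hy, neg_zero]
  have h3 (z : L) (hz : z ∈ H) (x y : L) : F x y z = 0 := by rw [← hF.rotate, h2 z hz]
  have h4 {α β : Weight K H L} (hα : α.IsNonZero) (hβ : β.IsNonZero) (hn : α ≠ β) (hn' : α ≠ -β)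
      {e f : L} (he : e ∈ rootSpace H α) (hf : f ∈ rootSpace H β) (z : L) : F e f z = 0 := by
    obtain ⟨t, ht, -, ht'⟩ := hF.exists_mul_apply_eq hα hβ hn hn'
    have := ht' e he f hf z
    rw [h t t.2] at this
    exact (mul_eq_zero.mp this).resolve_left ht
  have h5 {α : Weight K H L} (hα : α.IsNonZero) {e f : L} (he : e ∈ rootSpace H α)
      (hf : f ∈ rootSpace H α) (z : L) : F e f z = 0 := by
    by_cases he0 : e = 0
    · simp [he0]
    obtain ⟨c, rfl⟩ := exists_smul_eq_of_mem_rootSpace hα he hf he0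
    have h1 := hF.swap e e z
    rw [map_smul, LinearMap.smul_apply, show F e e z = 0 by linear_combination h1 / 2, smul_zero]
  revert y z
  induction x using rootSpace_induction H with
  | zero x hx => exact h x hx
  | add x x' hx hx' => intro y z; simp [hx, hx']
  | root α hα x hx =>
  intro y z
  revert z
  induction y using rootSpace_induction H with
  | zero y hy => exact h2 y hy x
  | add y y' hy hy' => intro z; simp [hy, hy']
  | root β hβ y hy =>
  by_cases hn : α = β
  · subst hn; exact h5 hα hx hy
  by_cases hn' : α = -β
  swap
  · exact h4 hα hβ hn hn' hx hy
  intro z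
  induction z using rootSpace_induction H with
  | zero z hz => exact h3 z hz x y
  | add z z' hz hz' => simp [hz, hz']
  | root γ hγ z hz =>
  by_cases h6 : β = γ
  · subst h6; rw [← hF.rotate]; exact h5 hβ hy hz x
  by_cases h7 : β = -γ
  · rw [h7, neg_neg] at hn'
    subst hn'
    rw [hF.swap_right x z y, h5 hα hx hz, neg_zero]
  · rw [← hF.rotate]; exact h4 hβ hγ h6 h7 hy hz x

variable (F) in
theorem exists_apply_eq_mul_killingForm {α : Weight K H L} (hα : α.IsNonZero) :
    ∃ c : K, ∀ s ∈ H, ∀ e ∈ rootSpace H α, ∀ z, F s e z = c * killingForm K L ⁅s, e⁆ z := by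
  obtain ⟨e₀, he₀, he₀'⟩ := α.exists_ne_zero
  obtain ⟨f₀, hf₀, hf₀'⟩ := exists_killingForm_ne_zero he₀ he₀'
  set u := coroot α
  have hu : α u = 2 := root_apply_coroot hα
  refine ⟨F u e₀ f₀ / (2 * killingForm K L e₀ f₀), fun s hs e he z ↦ ?_⟩
  obtain ⟨r, rfl⟩ := exists_smul_eq_of_mem_rootSpace hα he₀ he he₀'
  have h1 := hF.smul_apply_comm hα he₀ ⟨s, hs⟩ u z
  suffices F u e₀ z * killingForm K L e₀ f₀ = F u e₀ f₀ * killingForm K L e₀ z by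
    rw [← Subtype.coe_mk (p := (· ∈ H)) s hs, coe_lie_eq_smul_of_mem_rootSpace he]
    simp only [map_smul, LinearMap.smul_apply, smul_eq_mul]
    rw [hu] at h1
    field_simp
    linear_combination - r * killingForm K L e₀ f₀ * h1 + r * α ⟨s, hs⟩ * this
  clear h1
  induction z using rootSpace_induction H with
  | zero z hz =>
    rw [← hF.rotate, ← hF.rotate, hF.apply_eq_zero _ hz (lie_eq_zero_of_mem_cartan hz u.2),
      killingForm_apply_eq_zero_of_mem_rootSpace_of_add_ne_zero K L H (β := 0) (y := z) he₀]
    · simp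
    · rwa [rootSpace_zero_eq]
    · rwa [add_zero]
  | add z z' hz hz' =>
    simp only [map_add]
    linear_combination hz + hz'
  | root β hβ z hz =>
    by_cases hβα : β = -α
    · subst hβα
      obtain ⟨r, rfl⟩ := exists_smul_eq_of_mem_rootSpace hβ hf₀ hz (by rintro rfl; simp at hf₀')
      simp only [map_smul, smul_eq_mul]
      ring
    · rw [hF.apply_eq_zero_of_ne_neg hα hβ hβα he₀ hz,
        killingForm_apply_eq_zero_of_mem_rootSpace_of_add_ne_zero K L H he₀ hz]
      · simp
      · rw [Ne, add_comm, ← eq_neg_iff_add_eq_zero, ← Weight.coe_neg]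
        exact fun h ↦ hβα (DFunLike.coe_injective h)

section Scalars

variable {c : Weight K H L → K}
  (hc : ∀ α : Weight K H L, α.IsNonZero →
    ∀ s ∈ H, ∀ e ∈ rootSpace H α, ∀ z, F s e z = c α * killingForm K L ⁅s, e⁆ z)
include hc

theorem scalar_neg {α : Weight K H L} (hα : α.IsNonZero) : c (-α) = c α := by
  obtain ⟨e, he, he0⟩ := α.exists_ne_zero
  obtain ⟨f, hf, hf0⟩ := exists_killingForm_ne_zero he he0
  rw [← Weight.coe_neg] at hf
  set u := coroot α
  have hu : α u = 2 := root_apply_coroot hα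
  have h1 := hc α hα u u.2 e he f
  have h2 := hc (-α) (by simpa using hα) u u.2 f hf e
  rw [coe_lie_eq_smul_of_mem_rootSpace he, hu] at h1
  rw [coe_lie_eq_smul_of_mem_rootSpace hf, Weight.coe_neg, Pi.neg_apply, hu, hF.swap_right, h1,
    killingForm] at h2
  simp only [map_smul, LinearMap.smul_apply, smul_eq_mul] at h2
  rw [LieModule.traceForm_comm K L L f e] at h2
  rw [killingForm] at hf0
  refine mul_right_cancel₀ hf0 ?_
  linear_combination h2 / 2

theorem apply_eq_scalar_mul {α β δ : Weight K H L} (hα : α.IsNonZero) (hβ : β.IsNonZero)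
    (hδ : δ.IsNonZero) (h : α ≠ β) (h' : α ≠ -β) (hαβ : (δ : H → K) = α + β) {e f : L}
    (he : e ∈ rootSpace H α) (hf : f ∈ rootSpace H β) (z : L) :
    F e f z = c δ * killingForm K L ⁅e, f⁆ z := by
  obtain ⟨t, ht, ht0, key⟩ := hF.exists_mul_apply_eq hα hβ h h'
  have hef : ⁅e, f⁆ ∈ rootSpace H δ := by
    rw [hαβ]; exact lie_mem_genWeightSpace_of_mem_genWeightSpace he hf
  have h1 := key e he f hf z
  rw [hc δ hδ t t.2 _ hef, coe_lie_eq_smul_of_mem_rootSpace hef, hαβ, Pi.add_apply, ht0, add_zero,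
    map_smul, LinearMap.smul_apply, smul_eq_mul] at h1
  refine mul_left_cancel₀ ht ?_
  linear_combination h1

theorem scalar_add {α β δ : Weight K H L} (hα : α.IsNonZero) (hβ : β.IsNonZero)
    (hδ : δ.IsNonZero) (h : α ≠ β) (h' : α ≠ -β) (hαβ : (δ : H → K) = α + β) : c α = c δ := by
  obtain ⟨e, he, he0⟩ := α.exists_ne_zero
  obtain ⟨f, hf, hf0⟩ := β.exists_ne_zero
  have hef : ⁅e, f⁆ ∈ rootSpace H δ := by
    rw [hαβ]; exact lie_mem_genWeightSpace_of_mem_genWeightSpace he hf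
  obtain ⟨z, hz, hz0⟩ := exists_killingForm_ne_zero hef
    (lie_ne_zero_of_mem_rootSpace hα hβ hαβ he hf he0 hf0)
  rw [← Weight.coe_neg] at hz
  have hn : (-α).IsNonZero := by simpa using hα
  have h1 : β ≠ -δ := by
    intro h1
    have h2 : (α : H → K) = (-2 : K) • β := by
      have : (α : H → K) = δ - β := by rw [hαβ]; simp
      rw [this, h1, Weight.coe_neg]
      ext t
      simp
      ring
    exact (eq_neg_or_eq_of_eq_smul β α hα _ h2).elim h' h
  have h2 : β ≠ - -δ := by
    rw [neg_neg]
    rintro rfl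
    exact hα (by simpa using hαβ)
  have h3 : ((-α : Weight K H L) : H → K) = β + (-δ : Weight K H L) := by
    rw [Weight.coe_neg, Weight.coe_neg, hαβ]
    simp
  have h4 := hF.apply_eq_scalar_mul hc hα hβ hδ h h' hαβ he hf z
  have h5 := hF.apply_eq_scalar_mul hc hβ (by simpa using hδ) hn h1 h2 h3 hf hz e
  have h6 := (IsLocallyInvariant.lieKillingForm (K := K) (H := H)).rotate e f z
  rw [lieKillingForm_apply, lieKillingForm_apply] at h6
  rw [hF.rotate, h4, h6, hF.scalar_neg hc hα] at h5
  exact (mul_right_cancel₀ hz0 h5).symm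

theorem scalar_eq_of_apply_coroot_ne_zero (α β : H.root)
    (h : (β : Weight K H L) (coroot (α : Weight K H L)) ≠ 0) : c α = c β := by
  have hα := isNonZero_root α
  have hβ := isNonZero_root β
  by_cases h1 : (β : Weight K H L) = α
  · rw [h1]
  by_cases h2 : (β : Weight K H L) = -α
  · rw [h2, hF.scalar_neg hc hα]
  have h3 : (rootSystem H).pairingIn ℤ β α ≠ 0 := by
    intro h3
    have := (rootSystem H).algebraMap_pairingIn ℤ β α
    rw [h3, rootSystem_pairing_apply] at this
    exact h (by rw [← this]; simp)
  obtain h3 | h3 := lt_or_gt_of_ne h3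
  · obtain ⟨γ, hγ⟩ := (rootSystem H).root_add_root_mem_of_pairingIn_neg h3 (by
      intro h4
      refine h2 (DFunLike.coe_injective ?_)
      simpa using congrArg DFunLike.coe h4)
    simp only [rootSystem_root_apply] at hγ
    replace hγ := congrArg DFunLike.coe hγ
    have h5 := hF.scalar_add hc hβ hα (isNonZero_root γ) h1 h2 hγ
    have h6 := hF.scalar_add hc hα hβ (isNonZero_root γ) (Ne.symm h1)
      (fun h ↦ h2 (by rw [h, neg_neg])) (hγ.trans (add_comm _ _))
    rw [h5, h6]
  · obtain ⟨γ, hγ⟩ := (rootSystem H).root_sub_root_mem_of_pairingIn_pos h3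
      (fun h ↦ h1 (congrArg Subtype.val h))
    simp only [rootSystem_root_apply] at hγ
    replace hγ := congrArg DFunLike.coe hγ
    have hα' : (-(α : Weight K H L)).IsNonZero := by simpa using hα
    have hγ' : ((γ : Weight K H L) : H → K) = (β : Weight K H L) + (-α : Weight K H L) := by
      rw [Weight.coe_neg, ← sub_eq_add_neg]; exact hγ
    have h5 := hF.scalar_add hc hβ hα' (isNonZero_root γ) h2 (by rwa [neg_neg]) hγ'
    have h6 := hF.scalar_add hc hα' hβ (isNonZero_root γ) (Ne.symm h2)
      (fun h ↦ h1 (neg_injective h).symm) (hγ'.trans (add_comm _ _))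
    rw [h5, ← hF.scalar_neg hc hα, h6]

theorem scalar_eq [IsSimple K L] (α β : H.root) : c α = c β := by
  let q : Submodule K (Module.Dual K H) :=
    Submodule.span K ((rootSystem H).root '' {γ : H.root | c γ = c α})
  have hq : q = ⊤ := by
    refine RootPairing.IsIrreducible.eq_top_of_invtSubmodule_reflection (P := rootSystem H) q
      (fun i ↦ ?_) fun h ↦ ?_
    · rw [Module.End.mem_invtSubmodule, Submodule.span_le]
      rintro - ⟨γ, hγ, rfl⟩
      have hγq : (rootSystem H).root γ ∈ q := Submodule.subset_span ⟨γ, hγ, rfl⟩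
      simp only [SetLike.mem_coe, Submodule.mem_comap, LinearEquiv.coe_coe]
      rw [RootPairing.reflection_apply_root, rootSystem_pairing_apply]
      by_cases h0 : (γ : Weight K H L) (coroot (i : Weight K H L)) = 0
      · rwa [h0, zero_smul, sub_zero]
      · refine q.sub_mem hγq (q.smul_mem _ (Submodule.subset_span ⟨i, ?_, rfl⟩))
        exact (hF.scalar_eq_of_apply_coroot_ne_zero hc i γ h0).trans hγ
    · have h1 : (rootSystem H).root α ∈ q := Submodule.subset_span ⟨α, rfl, rfl⟩
      rw [h, Submodule.mem_bot] at h1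
      exact (rootSystem H).ne_zero α h1
  by_contra hne
  have h1 : q ≤ LinearMap.ker (Module.Dual.eval K H (coroot (β : Weight K H L))) := by
    rw [Submodule.span_le]
    rintro - ⟨γ, hγ, rfl⟩
    rw [SetLike.mem_coe, LinearMap.mem_ker, Module.Dual.eval_apply]
    by_contra h0
    exact hne (hγ.symm.trans (hF.scalar_eq_of_apply_coroot_ne_zero hc β γ h0).symm)
  have h2 : (rootSystem H).root β ∈ q := by rw [hq]; trivial
  have h3 := h1 h2
  rw [LinearMap.mem_ker, Module.Dual.eval_apply] at h3
  have h4 := root_apply_coroot (isNonZero_root β)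
  exact two_ne_zero (h4.symm.trans h3)

end Scalars

theorem exists_eq_mul_killingForm [IsSimple K L] :
    ∃ c : K, ∀ x y z, F x y z = c * killingForm K L ⁅x, y⁆ z := by
  choose! c hc using fun (α : Weight K H L) (hα : α.IsNonZero) ↦
    hF.exists_apply_eq_mul_killingForm F hα
  obtain ⟨d, hd⟩ : ∃ d : K, ∀ α : Weight K H L, α.IsNonZero → c α = d := by
    by_cases h : Nonempty H.root
    · obtain ⟨α⟩ := h
      exact ⟨c α, fun β hβ ↦ hF.scalar_eq hc ⟨β, by simpa using hβ⟩ α⟩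
    · exact ⟨0, fun β hβ ↦ (h ⟨β, by simpa using hβ⟩).elim⟩
  refine ⟨d, fun x y z ↦ ?_⟩
  have hG := hF.add_smul (IsLocallyInvariant.lieKillingForm (K := K) (H := H)) (-d)
  have := hG.eq_zero_of_apply_cartan (fun s hs y z ↦ ?_) x y z
  · simp at this
    linear_combination this
  simp only [LinearMap.add_apply, LinearMap.smul_apply, smul_eq_mul, lieKillingForm_apply]
  induction y using rootSpace_induction H with
  | zero y hy =>
    have := lie_eq_zero_of_mem_cartan hs hy
    rw [hF.apply_eq_zero z hs this, this]
    simp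
  | add y y' hy hy' =>
    simp only [map_add, LinearMap.add_apply, lie_add]
    linear_combination hy + hy'
  | root α hα y hy =>
    rw [hc α hα s hs y hy, hd α hα]
    ring

end IsLocallyInvariant

end RootSpace

end LieAlgebra

namespace Polynomial

variable {K A : Type*} [Field K] [Ring A] [Algebra K A]

/-- Evaluation at a scalar, as an algebra homomorphism on polynomials over a noncommutative
algebra. -/
noncomputable def evalScalar (A : Type*) [Ring A] [Algebra K A] (t : K) : A[X] →ₐ[K] A :=
  AlgHom.mk' (eval₂RingHom' (RingHom.id A) (algebraMap K A t) fun a ↦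
    (Algebra.commutes t a).symm) fun c p ↦ by
      simp [eval₂RingHom', eval₂_id, eval_smul]

theorem evalScalar_apply (t : K) (P : A[X]) : evalScalar A t P = P.eval (algebraMap K A t) := rfl

theorem evalScalar_monomial (t : K) (n : ℕ) (a : A) :
    evalScalar A t (monomial n a) = t ^ n • a := by
  rw [evalScalar_apply, eval_monomial, ← map_pow, ← Algebra.commutes, Algebra.smul_def]

end Polynomial

theorem eq_zero_of_forall_sum_pow_smul_eq_zero {K V : Type*} [Field K] [Infinite K]
    [AddCommGroup V] [Module K V] {n : ℕ} {v : ℕ → V}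
    (h : ∀ t : K, ∑ i ∈ Finset.range n, t ^ i • v i = 0) {k : ℕ} (hk : k < n) : v k = 0 := by
  rw [← Module.forall_dual_apply_eq_zero_iff K]
  intro f
  let p : Polynomial K := ∑ i ∈ Finset.range n, Polynomial.monomial i (f (v i))
  have hp : p = 0 := by
    refine Polynomial.funext fun t ↦ ?_
    have := congrArg f (h t)
    simp only [map_sum, map_smul, smul_eq_mul, map_zero] at this
    simp only [p, Polynomial.eval_finsetSum, Polynomial.eval_monomial, Polynomial.eval_zero]
    rw [← this]
    exact Finset.sum_congr rfl fun i _ ↦ mul_comm _ _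
  have := congrArg (Polynomial.coeff · k) hp
  simpa [p, Polynomial.finsetSum_coeff, Polynomial.coeff_monomial, hk] using this

theorem Polynomial.eq_zero_of_forall_evalScalar_eq_zero {K A : Type*} [Field K] [Infinite K]
    [Ring A] [Algebra K A] {P : Polynomial A} (h : ∀ t : K, evalScalar A t P = 0) : P = 0 := by
  ext k
  by_cases hk : k < P.natDegree + 1
  · refine eq_zero_of_forall_sum_pow_smul_eq_zero (K := K) (fun t ↦ ?_) hk
    have := h t
    rw [P.as_sum_range, map_sum] at this
    simpa only [evalScalar_monomial] using this
  · rw [coeff_eq_zero_of_natDegree_lt (by omega), coeff_zero]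

theorem LinearMap.apply_add_apply_eq_zero_of_forall_sum_pow {K V W : Type*} [Field K] [Infinite K]
    [AddCommGroup V] [Module K V] [AddCommGroup W] [Module K W] (B : V →ₗ[K] V →ₗ[K] W) {n : ℕ}
    {v w : ℕ → V} (h : ∀ t : K, B (∑ i ∈ Finset.range (n + 2), t ^ i • v i)
      (∑ i ∈ Finset.range (n + 2), t ^ i • w i) = 0) : B (v 1) (w 0) + B (v 0) (w 1) = 0 := by
  rw [← Module.forall_dual_apply_eq_zero_iff K]
  intro f
  let p : Polynomial K := ∑ i ∈ Finset.range (n + 2), ∑ j ∈ Finset.range (n + 2),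
    Polynomial.monomial (i + j) (f (B (v i) (w j)))
  have hp : p = 0 := by
    refine Polynomial.funext fun t ↦ ?_
    have := congrArg f (h t)
    simp only [map_sum, map_smul, smul_eq_mul, map_zero, LinearMap.sum_apply,
      LinearMap.smul_apply] at this
    simp only [p, Polynomial.eval_finsetSum, Polynomial.eval_monomial, Polynomial.eval_zero]
    rw [← this, Finset.sum_comm]
    refine Finset.sum_congr rfl fun i _ ↦ ?_
    rw [Finset.mul_sum]
    refine Finset.sum_congr rfl fun j _ ↦ ?_
    ring
  have := congrArg (Polynomial.coeff · 1) hp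
  simp only [p, Polynomial.finsetSum_coeff, Polynomial.coeff_monomial,
    Polynomial.coeff_zero] at this
  simpa [Finset.sum_range_succ', ← add_assoc] using this

namespace Module.End

open Polynomial

variable {K V : Type*} [Field K] [AddCommGroup V] [Module K V]

theorem trace_coeff_one_pow_mul (P : (End K V)[X]) (Z : End K V) (hZ : Commute (P.coeff 0) Z)
    (k : ℕ) : LinearMap.trace K V ((P ^ k).coeff 1 * Z) =
      k * LinearMap.trace K V (P.coeff 1 * P.coeff 0 ^ (k - 1) * Z) := by
  induction k generalizing Z with
  | zero => simp [coeff_one]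
  | succ k ih =>
    have h0 : (P ^ k).coeff 0 = P.coeff 0 ^ k := map_pow constantCoeff P k
    have h1 : LinearMap.trace K V (P.coeff 0 ^ k * P.coeff 1 * Z) =
        LinearMap.trace K V (P.coeff 1 * P.coeff 0 ^ k * Z) := by
      rw [mul_assoc, LinearMap.trace_mul_comm, mul_assoc, ← (hZ.pow_left k).eq, mul_assoc]
    rw [pow_succ, mul_coeff_one, h0, add_mul, map_add, h1, mul_assoc ((P ^ k).coeff 1),
      ih _ ((Commute.refl _).mul_right hZ), Nat.add_sub_cancel]
    obtain _ | k := k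
    · simp
    · rw [Nat.add_sub_cancel, ← mul_assoc, mul_assoc (P.coeff 1) _ (P.coeff 0), ← pow_succ]
      push_cast
      ring

theorem trace_coeff_one_aeval_mul (P : (End K V)[X]) (Z : End K V) (hZ : Commute (P.coeff 0) Z)
    (p : K[X]) : LinearMap.trace K V ((aeval P p).coeff 1 * Z) =
      LinearMap.trace K V (P.coeff 1 * aeval (P.coeff 0) (derivative p) * Z) := by
  induction p using Polynomial.induction_on' with
  | add p q hp hq => simp only [map_add, coeff_add, add_mul, mul_add, hp, hq]
  | monomial n a =>
    have h := trace_coeff_one_pow_mul P Z hZ n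
    rw [aeval_monomial, derivative_monomial, aeval_monomial, ← Algebra.smul_def,
      ← Algebra.smul_def, coeff_smul, smul_mul_assoc, map_smul, h, mul_smul_comm, smul_mul_assoc,
      map_smul, smul_eq_mul, smul_eq_mul]
    ring

theorem trace_coeff_one_mul_eq_zero {P : (End K V)[X]} {Z : End K V} (hZ : Commute (P.coeff 0) Z)
    {p : K[X]} (hp : p.Separable) (h : aeval P p = 0) :
    LinearMap.trace K V (P.coeff 1 * Z) = 0 := by
  obtain ⟨a, b, hab⟩ := hp
  have h0 : aeval (P.coeff 0) p = 0 := by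
    have h1 : evalScalar (End K V) (0 : K) P = P.coeff 0 := by
      rw [evalScalar_apply, map_zero, coeff_zero_eq_eval_zero]
    rw [← h1, aeval_algHom_apply, h, map_zero]
  have h1 : aeval (P.coeff 0) (derivative p) * aeval (P.coeff 0) b = 1 := by
    have := congrArg (aeval (P.coeff 0)) hab
    rw [map_add, map_mul, map_mul, h0, mul_zero, zero_add, map_one] at this
    rw [← map_mul, mul_comm, map_mul, this]
  have h2 : Commute (P.coeff 0) (aeval (P.coeff 0) b * Z) :=
    Commute.mul_right (by simpa using (Commute.all X b).map (aeval (R := K) (P.coeff 0))) hZ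
  have h3 := trace_coeff_one_aeval_mul P _ h2 p
  rwa [h, coeff_zero, zero_mul, map_zero, mul_assoc, ← mul_assoc (aeval _ _), h1, one_mul,
    eq_comm] at h3

end Module.End

namespace LieAlgebra

theorem exists_equiv_apply_eq_sum_pow_smul {K L : Type*} [Field K] [CharZero K] [LieRing L]
    [LieAlgebra K L] {a : L} (ha : IsNilpotent (ad K L a)) :
    ∃ n : ℕ, ∀ t : K, ∃ E : L ≃ₗ⁅K⁆ L, ∀ x, E x =
      ∑ i ∈ Finset.range (n + 2), t ^ i • (i.factorial : K)⁻¹ • ((ad K L a) ^ i) x := by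
  obtain ⟨n, hn⟩ := ha
  refine ⟨n, fun t ↦ ?_⟩
  have hpow (i : ℕ) : (ad K L (t • a)) ^ i = t ^ i • (ad K L a) ^ i := by
    rw [map_smul, smul_pow]
  obtain ⟨E, hE⟩ := exists_equiv_apply_eq_sum (K := K) (a := t • a)
    ⟨n, by rw [hpow, hn, smul_zero]⟩
  refine ⟨E, fun x ↦ (hE (n + 2) x ?_).trans (Finset.sum_congr rfl fun i _ ↦ ?_)⟩
  · rw [hpow, pow_add (ad K L a), hn, zero_mul, smul_zero, LinearMap.zero_apply]
  · rw [hpow, LinearMap.smul_apply, smul_comm]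

theorem minpoly_ad_equiv_apply {K L : Type*} [Field K] [LieRing L] [LieAlgebra K L]
    (e : L ≃ₗ⁅K⁆ L) (x : L) : minpoly K (ad K L (e x)) = minpoly K (ad K L x) := by
  rw [← conj_ad_apply]
  exact minpoly.algEquiv_eq (e.toLinearEquiv.conjAlgEquiv K) (ad K L x)

end LieAlgebra

namespace IsLocalAutomorphism

variable {K L : Type*} [Field K] [LieRing L] [LieAlgebra K L] {φ : L →ₗ[K] L}
  (hφ : IsLocalAutomorphism K L φ)
include hφ

theorem injective : Function.Injective φ := by
  rw [← LinearMap.ker_eq_bot, LinearMap.ker_eq_bot']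
  intro x hx
  obtain ⟨e, he⟩ := hφ x
  rw [hx] at he
  simpa using he.symm

theorem minpoly_ad_apply (x : L) : minpoly K (ad K L (φ x)) = minpoly K (ad K L x) := by
  obtain ⟨e, he⟩ := hφ x
  rw [he, minpoly_ad_equiv_apply]

theorem killingForm_apply [CharZero K] (x y : L) :
    killingForm K L (φ x) (φ y) = killingForm K L x y := by
  have h (x : L) : killingForm K L (φ x) (φ x) = killingForm K L x x := by
    obtain ⟨e, he⟩ := hφ x
    rw [he, killingForm_of_equiv_apply]
  have h1 := h (x + y)
  have h2 : killingForm K L y x = killingForm K L x y := traceForm_comm K L L y x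
  have h3 : killingForm K L (φ y) (φ x) = killingForm K L (φ x) (φ y) :=
    traceForm_comm K L L _ _
  simp only [map_add, LinearMap.add_apply] at h1
  linear_combination (h1 - h x - h y - h3 + h2) / 2

theorem finrank_ker_ad_apply (x : L) : Module.finrank K (LinearMap.ker (ad K L (φ x))) =
    Module.finrank K (LinearMap.ker (ad K L x)) := by
  obtain ⟨e, he⟩ := hφ x
  have key : LinearMap.ker (ad K L (e x)) =
      (LinearMap.ker (ad K L x)).map (e.toLinearEquiv : L →ₗ[K] L) := by
    ext y
    rw [Submodule.map_equiv_eq_comap_symm, Submodule.mem_comap, LinearMap.mem_ker,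
      LinearMap.mem_ker, ad_apply, ad_apply]
    have h : e ⁅x, e.symm y⁆ = ⁅e x, y⁆ := by rw [LieEquiv.map_lie, LieEquiv.apply_symm_apply]
    rw [← h]
    exact LinearEquiv.map_eq_zero_iff e.toLinearEquiv
  rw [he, key, LinearEquiv.finrank_map_eq]

variable [FiniteDimensional K L]

theorem surjective : Function.Surjective φ :=
  LinearMap.injective_iff_surjective.mp hφ.injective

theorem killingForm_apply_lie_eq_zero [CharZero K] {s a z : L} (hs : (ad K L s).IsSemisimple)
    (ha : IsNilpotent (ad K L a)) (hz : ⁅φ s, z⁆ = 0) : killingForm K L (φ ⁅a, s⁆) z = 0 := by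
  obtain ⟨n, hn⟩ := exists_equiv_apply_eq_sum_pow_smul (K := K) ha
  let P : Polynomial (Module.End K L) := ∑ i ∈ Finset.range (n + 2),
    Polynomial.monomial i (ad K L (φ ((i.factorial : K)⁻¹ • ((ad K L a) ^ i) s)))
  have hP0 : P.coeff 0 = ad K L (φ s) := by
    simp [P, Polynomial.finsetSum_coeff, Polynomial.coeff_monomial]
  have hP1 : P.coeff 1 = ad K L (φ ⁅a, s⁆) := by
    simp [P, Polynomial.finsetSum_coeff, Polynomial.coeff_monomial]
  have hcomm : Commute (P.coeff 0) (ad K L z) := by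
    rw [hP0, commute_iff_eq, ← sub_eq_zero, ← ad_lie_eq_mul_sub_mul, hz, map_zero]
  have hsep : (minpoly K (ad K L s)).Separable :=
    PerfectField.separable_iff_squarefree.mpr hs.minpoly_squarefree
  have := Module.End.trace_coeff_one_mul_eq_zero hcomm hsep
    (Polynomial.eq_zero_of_forall_evalScalar_eq_zero (K := K) fun t ↦ ?_)
  · rwa [hP1] at this
  obtain ⟨E, hE⟩ := hn t
  have h1 : Polynomial.evalScalar _ t P = ad K L (φ (E s)) := by
    simp only [P, map_sum, Polynomial.evalScalar_monomial, hE, map_smul]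
  rw [← Polynomial.aeval_algHom_apply, h1, ← minpoly_ad_equiv_apply E, ← hφ.minpoly_ad_apply,
    minpoly.aeval]

variable [CharZero K] [IsAlgClosed K] [IsKilling K L]

theorem lie_apply_eq_zero {s y : L} (hs : (ad K L s).IsSemisimple) (hy : ⁅s, y⁆ = 0) :
    ⁅φ s, φ y⁆ = 0 := by
  obtain ⟨H, hH, hsH⟩ := exists_isCartanSubalgebra_of_subset (K := K) (S := {s})
    (by simpa using hs) (by simp)
  have hsH : s ∈ H := hsH rfl
  have hle : (LinearMap.ker (ad K L (φ s))).comap φ ≤ LinearMap.ker (ad K L s) := by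
    intro z hz
    rw [Submodule.mem_comap, LinearMap.mem_ker, ad_apply] at hz
    rw [LinearMap.mem_ker, ad_apply]
    refine (killingForm_nondegenerate K L).2 _ fun a ↦ ?_
    rw [killingForm, ← traceForm_apply_lie_apply, ← killingForm, ← hφ.killingForm_apply]
    induction a using rootSpace_induction H with
    | zero a ha => rw [lie_eq_zero_of_mem_cartan ha hsH]; simp
    | root α hα a ha =>
      exact hφ.killingForm_apply_lie_eq_zero hs (isNilpotent_ad_of_mem_rootSpace H hα ha) hz
    | add a b ha hb => rw [add_lie, map_add, map_add, LinearMap.add_apply, ha, hb, add_zero]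
  let Φ : L ≃ₗ[K] L := LinearEquiv.ofBijective φ ⟨hφ.injective, hφ.surjective⟩
  have hcomap : (LinearMap.ker (ad K L (φ s))).comap φ =
      (LinearMap.ker (ad K L (φ s))).map (Φ.symm : L →ₗ[K] L) := by
    rw [Submodule.map_equiv_eq_comap_symm, LinearEquiv.symm_symm]
    rfl
  have heq := Submodule.eq_of_le_of_finrank_eq hle (by
    rw [hcomap, LinearEquiv.finrank_map_eq, hφ.finrank_ker_ad_apply])
  have : y ∈ (LinearMap.ker (ad K L (φ s))).comap φ := by
    rwa [heq, LinearMap.mem_ker, ad_apply]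
  simpa using this

theorem lie_apply_lie_add_eq_zero {s y a : L} (hs : (ad K L s).IsSemisimple) (hy : ⁅s, y⁆ = 0)
    (ha : IsNilpotent (ad K L a)) : ⁅φ ⁅a, s⁆, φ y⁆ + ⁅φ s, φ ⁅a, y⁆⁆ = 0 := by
  obtain ⟨n, hn⟩ := exists_equiv_apply_eq_sum_pow_smul (K := K) ha
  have := LinearMap.apply_add_apply_eq_zero_of_forall_sum_pow
    (LinearMap.compl₁₂ (ad K L : L →ₗ[K] L →ₗ[K] L) φ φ) (n := n)
    (v := fun i ↦ (i.factorial : K)⁻¹ • ((ad K L a) ^ i) s)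
    (w := fun i ↦ (i.factorial : K)⁻¹ • ((ad K L a) ^ i) y) fun t ↦ ?_
  · simpa using this
  obtain ⟨E, hE⟩ := hn t
  rw [← hE, ← hE]
  refine hφ.lie_apply_eq_zero (Module.End.isSemisimple_of_squarefree_aeval_eq_zero
    hs.minpoly_squarefree ?_) ?_
  · rw [← minpoly_ad_equiv_apply E, minpoly.aeval]
  · rw [← LieEquiv.map_lie, hy, map_zero]

theorem isLocallyInvariant (H : LieSubalgebra K L) [H.IsCartanSubalgebra]
    {F : L →ₗ[K] L →ₗ[K] L →ₗ[K] K} (hF : ∀ x y z, F x y z = killingForm K L ⁅φ x, φ y⁆ (φ z)) :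
    IsLocallyInvariant H F where
  swap x y z := by
    simpa [hF] using (IsLocallyInvariant.lieKillingForm (H := H)).swap (φ x) (φ y) (φ z)
  rotate x y z := by
    simpa [hF] using (IsLocallyInvariant.lieKillingForm (H := H)).rotate (φ x) (φ y) (φ z)
  apply_eq_zero z hs h := by
    rw [hF, hφ.lie_apply_eq_zero (isSemisimple_ad_of_mem_isCartanSubalgebra hs) h, map_zero,
      LinearMap.zero_apply]
  apply_lie z hs h hα ha := by
    have := hφ.lie_apply_lie_add_eq_zero (isSemisimple_ad_of_mem_isCartanSubalgebra hs) h
      (isNilpotent_ad_of_mem_rootSpace H hα ha)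
    rw [hF, hF, ← LinearMap.add_apply, ← map_add, this, map_zero, LinearMap.zero_apply]

theorem exists_lie_apply_eq_smul [IsSimple K L] : ∃ c : K, ∀ x y, ⁅φ x, φ y⁆ = c • φ ⁅x, y⁆ := by
  obtain ⟨H, hH, -⟩ := exists_isCartanSubalgebra_of_subset (K := K) (L := L) (S := ∅)
    (by simp) (by simp)
  have hF (x y z : L) : ((lieKillingForm K L).compl₁₂ φ φ).compr₂ (LinearMap.lcomp K K φ) x y z =
      killingForm K L ⁅φ x, φ y⁆ (φ z) := rfl
  obtain ⟨c, hc⟩ := (hφ.isLocallyInvariant H hF).exists_eq_mul_killingForm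
  refine ⟨c, fun x y ↦ ?_⟩
  rw [← sub_eq_zero]
  refine (killingForm_nondegenerate K L).1 _ fun z ↦ ?_
  obtain ⟨z, rfl⟩ := hφ.surjective z
  have h := hc x y z
  rw [hF, ← hφ.killingForm_apply ⁅x, y⁆ z] at h
  simp [h]

end IsLocalAutomorphism

theorem LinearMap.exists_lieEquiv_apply_eq {K L : Type*} [Field K] [LieRing L] [LieAlgebra K L]
    (ψ : L →ₗ[K] L) (hψ : Function.Bijective ψ) (h : ∀ x y, ψ ⁅x, y⁆ = ⁅ψ x, ψ y⁆) :
    ∃ e : L ≃ₗ⁅K⁆ L, ∀ x, e x = ψ x :=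
  ⟨LieEquiv.ofBijective { ψ with map_lie' := fun {x y} ↦ h x y } hψ, fun _ ↦ rfl⟩

theorem IsLocalAutomorphism.lie_apply_eq_or_eq_neg {K L : Type*} [Field K] [IsAlgClosed K]
    [CharZero K] [LieRing L] [LieAlgebra K L] [FiniteDimensional K L] [IsSimple K L]
    {φ : L →ₗ[K] L} (hφ : IsLocalAutomorphism K L φ) :
    (∀ x y : L, φ ⁅x, y⁆ = ⁅φ x, φ y⁆) ∨ (∀ x y : L, φ ⁅x, y⁆ = ⁅φ y, φ x⁆) := by
  obtain ⟨c, hc⟩ := hφ.exists_lie_apply_eq_smul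
  obtain ⟨u, v, huv⟩ : ∃ u v : L, ⁅u, v⁆ ≠ 0 := by
    by_contra! h
    exact IsSimple.non_abelian K (L := L) ⟨h⟩
  have hc0 : c ≠ 0 := by
    rintro rfl
    obtain ⟨x, rfl⟩ := hφ.surjective u
    obtain ⟨y, rfl⟩ := hφ.surjective v
    exact huv (by rw [hc, zero_smul])
  have hcc : c⁻¹ * c⁻¹ = 1 := by
    obtain ⟨e, he⟩ := (c⁻¹ • φ).exists_lieEquiv_apply_eq
      ((LinearEquiv.smulOfNeZero K L c⁻¹ (inv_ne_zero hc0)).bijective.comp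
        ⟨hφ.injective, hφ.surjective⟩) fun x y ↦ by
      simp only [LinearMap.smul_apply, smul_lie, lie_smul, hc]
      rw [inv_smul_smul₀ hc0]
    obtain ⟨w, hw⟩ : ∃ w, killingForm K L ⁅u, v⁆ w ≠ 0 := by
      by_contra! h
      exact huv ((killingForm_nondegenerate K L).1 _ h)
    have h := killingForm_of_equiv_apply e ⁅u, v⁆ w
    rw [he, he, LinearMap.smul_apply, LinearMap.smul_apply, map_smul, map_smul,
      LinearMap.smul_apply, hφ.killingForm_apply, smul_eq_mul, smul_eq_mul, ← mul_assoc] at h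
    exact (mul_eq_right₀ hw).mp h
  obtain h | h := mul_self_eq_one_iff.mp hcc
  · rw [inv_eq_one] at h
    exact Or.inl fun x y ↦ by rw [hc, h, one_smul]
  · rw [inv_eq_iff_eq_inv, inv_neg, inv_one] at h
    exact Or.inr fun x y ↦ by rw [← lie_skew, hc, h, neg_smul, one_smul, map_neg]

theorem local_automorphism_iff_aut_or_antiaut
    (K L : Type*) [Field K] [IsAlgClosed K] [CharZero K]
    [LieRing L] [LieAlgebra K L] [FiniteDimensional K L] [LieAlgebra.IsSimple K L]
    (φ : L →ₗ[K] L) :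
    IsLocalAutomorphism K L φ ↔
      ((Function.Bijective φ ∧ ∀ x y : L, φ ⁅x, y⁆ = ⁅φ x, φ y⁆) ∨
       (Function.Bijective φ ∧ ∀ x y : L, φ ⁅x, y⁆ = ⁅φ y, φ x⁆)) := by
  constructor
  · intro hφ
    have hbij : Function.Bijective φ := ⟨hφ.injective, hφ.surjective⟩
    exact hφ.lie_apply_eq_or_eq_neg.imp (⟨hbij, ·⟩) (⟨hbij, ·⟩)
  · rintro (⟨hbij, h⟩ | ⟨hbij, h⟩) x
    · obtain ⟨e, he⟩ := φ.exists_lieEquiv_apply_eq hbij h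
      exact ⟨e, (he x).symm⟩
    · obtain ⟨e, he⟩ := (-φ).exists_lieEquiv_apply_eq (neg_involutive.bijective.comp hbij) <|
        fun x y ↦ by
          rw [LinearMap.neg_apply, LinearMap.neg_apply, LinearMap.neg_apply, h, neg_lie, lie_neg,
            neg_neg, lie_skew]
      obtain ⟨θ, hθ⟩ := exists_equiv_apply_eq_neg (K := K) x
      exact ⟨θ.trans e, by rw [LieEquiv.trans_apply, hθ, he]; simp⟩
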